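/- arXiv:1605.05276 — 7 statements merged into one kernel-verified Lean document; each statement's English description precedes it below -/
import Mathlib

section
/- Let X and Y be compact metrizable topological spaces, let E be a dense linear subspace of C_p(X) and F a dense linear subspace of C_p(Y), and let T : E → F be a surjective continuous linear map (E and F carrying the subspace topologies). If X is totally disconnected, then Y is totally disconnected. -/
/-- `Cp X` is the space of continuous real-valued functions on `X`, as a submodule of
`X → ℝ`; its coercion to a type carries the subspace topology induced from the product
topology on `X → ℝ`, i.e. the topology of pointwise convergence. -/
def Cp (X : Type*) [TopologicalSpace X] : Submodule ℝ (X → ℝ) where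
  carrier := {f | Continuous f}
  add_mem' hf hg := hf.add hg
  zero_mem' := continuous_const
  smul_mem' c _f hf := hf.const_smul c

open Set in
/-- A connected compact Hausdorff space covered by countably many closed totally disconnected
sets has at most one point. -/
theorem subsingleton_of_iUnion_isTotallyDisconnected {C ι : Type*} [TopologicalSpace C]
    [CompactSpace C] [T2Space C] [PreconnectedSpace C] [Countable ι] {D : ι → Set C}
    (hc : ∀ i, IsClosed (D i)) (hd : ∀ i, IsTotallyDisconnected (D i))
    (hU : ⋃ i, D i = univ) : Subsingleton C := by
  rcases isEmpty_or_nonempty C with h | h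
  · infer_instance
  obtain ⟨i, p, hp⟩ := nonempty_interior_of_iUnion_of_closed hc hU
  suffices h : ∀ q, q = p from ⟨fun a b => (h a).trans (h b).symm⟩
  intro q
  by_contra hq
  have hopen : IsOpen (interior (D i) ∩ {q}ᶜ) := isOpen_interior.inter isOpen_compl_singleton
  obtain ⟨K, hK, hKc, hKU⟩ := exists_mem_nhds_isClosed_subset
    (hopen.mem_nhds ⟨hp, fun h => hq (mem_singleton_iff.1 h).symm⟩)
  have hKD : K ⊆ D i := fun x hx => interior_subset (hKU hx).1
  have : TotallyDisconnectedSpace K :=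
    totallyDisconnectedSpace_subtype_iff.2 fun t ht => hd i t (ht.trans hKD)
  have : CompactSpace K := isCompact_iff_compactSpace.1 hKc.isCompact
  obtain ⟨W, hW, hpW, hWK⟩ := compact_exists_isClopen_in_isOpen
    (X := K) (x := ⟨p, mem_of_mem_nhds hK⟩)
    (isOpen_interior.preimage continuous_subtype_val) (mem_interior_iff_mem_nhds.2 hK)
  have hWopen : IsOpen (Subtype.val '' W : Set C) := by
    obtain ⟨O, hO, rfl⟩ := isOpen_induced_iff.1 hW.isOpen
    have : (Subtype.val '' (Subtype.val ⁻¹' O : Set K) : Set C) = O ∩ interior K := by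
      ext x
      constructor
      · rintro ⟨y, hy, rfl⟩
        exact ⟨hy, hWK hy⟩
      · rintro ⟨hx, hxK⟩
        exact ⟨⟨x, interior_subset hxK⟩, hx, rfl⟩
    rw [this]
    exact hO.inter isOpen_interior
  have hWcl : IsClopen (Subtype.val '' W : Set C) :=
    ⟨hKc.isClosedEmbedding_subtypeVal.isClosedMap _ hW.isClosed, hWopen⟩
  have huniv := hWcl.eq_univ ⟨p, _, hpW, rfl⟩
  obtain ⟨y, -, hy⟩ := huniv.ge (mem_univ q)
  exact (hKU (hy ▸ y.2)).2 rfl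

open Set in
/-- The countable sum theorem for totally disconnected compact Hausdorff spaces. -/
theorem totallyDisconnectedSpace_of_iUnion {Y ι : Type*} [TopologicalSpace Y]
    [CompactSpace Y] [T2Space Y] [Countable ι] {D : ι → Set Y}
    (hc : ∀ i, IsClosed (D i)) (hd : ∀ i, IsTotallyDisconnected (D i))
    (hU : ⋃ i, D i = univ) : TotallyDisconnectedSpace Y := by
  refine totallyDisconnectedSpace_iff_connectedComponent_subsingleton.2 fun y => ?_
  have : CompactSpace (connectedComponent y) :=
    isCompact_iff_compactSpace.1 isClosed_connectedComponent.isCompact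
  have : PreconnectedSpace (connectedComponent y) :=
    Subtype.preconnectedSpace isPreconnected_connectedComponent
  rw [← subsingleton_coe]
  refine subsingleton_of_iUnion_isTotallyDisconnected
    (D := fun i => (Subtype.val ⁻¹' D i : Set (connectedComponent y)))
    (fun i => (hc i).preimage continuous_subtype_val) (fun i => ?_) ?_
  · refine isTotallyDisconnected_of_image continuous_subtype_val.continuousOn
      Subtype.val_injective fun t ht => hd i t (ht.trans (image_preimage_subset _ _))
  · rw [← preimage_iUnion, hU, preimage_univ]

open Set TopologicalSpace in
/-- Let `Y` be a compact Hausdorff space indexing a linearly independent family of finitely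
supported measures `φ y` on a compact totally disconnected space `X`. If the `φ y` vary
continuously with respect to a family of continuous functions separating the finitely supported
measures, then `Y` is totally disconnected. -/
theorem totallyDisconnectedSpace_of_linearIndependent {X Y ι : Type*} [TopologicalSpace X]
    [TopologicalSpace Y] [CompactSpace X] [MetrizableSpace X] [TotallyDisconnectedSpace X]
    [CompactSpace Y] [MetrizableSpace Y] (e : ι → X → ℝ) (he : ∀ i, Continuous (e i))
    (hsep : ∀ c : X →₀ ℝ, (∀ i, Finsupp.linearCombination ℝ (e i) c = 0) → c = 0)
    (φ : Y → X →₀ ℝ) (hφ : ∀ i, Continuous fun y => Finsupp.linearCombination ℝ (e i) (φ y))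
    (hli : LinearIndependent ℝ φ) : TotallyDisconnectedSpace Y := by
  classical
  let _ := metrizableSpaceMetric Y
  have : Countable (Clopens X) := Clopens.countable_iff_secondCountable.2 inferInstance
  let K : ℕ → Set ℝ := fun n => {t | (1 : ℝ) / (n + 1) ≤ |t| ∧ |t| ≤ n + 1}
  have hK : ∀ n, IsCompact (K n) := fun n => by
    refine (isCompact_Icc (a := -((n : ℝ) + 1)) (b := n + 1)).of_isClosed_subset ?_
      fun t ht => abs_le.1 ht.2
    exact (isClosed_le continuous_const continuous_abs).inter
      (isClosed_le continuous_abs continuous_const)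
  have hK0 : ∀ n, ∀ t ∈ K n, t ≠ 0 := fun n t ht => by
    have : (0 : ℝ) < 1 / (n + 1) := by positivity
    exact abs_pos.1 (this.trans_le ht.1)
  let I := (Σ k : ℕ, {V : Fin k → Clopens X // Pairwise fun i j =>
    Disjoint (V i : Set X) (V j)}) × ℕ
  let A : ∀ j : I, Set (Y × (Fin j.1.1 → X) × (Fin j.1.1 → ℝ)) := fun j =>
    {p | p.2.1 ∈ pi univ (fun i => (j.1.2.1 i : Set X)) ∧ p.2.2 ∈ pi univ (fun _ => K j.2) ∧
      φ p.1 = ∑ i, Finsupp.single (p.2.1 i) (p.2.2 i)}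
  have hAc : ∀ j, IsCompact (A j) := by
    rintro ⟨⟨k, V, hV⟩, n⟩
    have h1 : IsCompact ((univ : Set Y) ×ˢ
        ((pi univ fun i => (V i : Set X)) ×ˢ (pi univ fun _ : Fin k => K n))) :=
      isCompact_univ.prod ((isCompact_univ_pi fun i => (V i).isClopen.isClosed.isCompact).prod
        (isCompact_univ_pi fun _ => hK n))
    have h2 : IsClosed {p : Y × (Fin k → X) × (Fin k → ℝ) |
        φ p.1 = ∑ i, Finsupp.single (p.2.1 i) (p.2.2 i)} := by
      have : {p : Y × (Fin k → X) × (Fin k → ℝ) |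
          φ p.1 = ∑ i, Finsupp.single (p.2.1 i) (p.2.2 i)} =
          ⋂ a, {p | Finsupp.linearCombination ℝ (e a) (φ p.1) =
            ∑ i, p.2.2 i * e a (p.2.1 i)} := by
        ext p
        simp only [mem_ofPred_eq, mem_iInter]
        constructor
        · intro h a
          simp [h, map_sum]
        · intro h
          refine sub_eq_zero.1 (hsep _ fun a => ?_)
          simp [map_sub, h, map_sum]
      rw [this]
      refine isClosed_iInter fun a => isClosed_eq ((hφ a).comp continuous_fst) ?_
      have := he a
      fun_prop
    convert h1.inter_right h2 using 1
    ext p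
    simp only [A, mem_ofPred_eq, mem_inter_iff, mem_prod, mem_univ, true_and, and_assoc]
  have hinj : ∀ j, Function.Injective fun p : A j => p.1.1 := by
    rintro ⟨⟨k, V, hV⟩, n⟩ ⟨⟨y, x, l⟩, hx, hl, hy⟩ ⟨⟨y', x', l'⟩, hx', hl', hy'⟩ (rfl : y = y')
    simp only [mem_univ_pi] at hx hl hy hx' hl' hy'
    have key : ∀ (x : Fin k → X) (l : Fin k → ℝ), (∀ i, x i ∈ (V i : Set X)) →
        ∀ i, ∀ z ∈ (V i : Set X), (∑ j, Finsupp.single (x j) (l j)) z =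
          if x i = z then l i else 0 := by
      intro x l hx i z hz
      rw [Finsupp.finsetSum_apply, Finset.sum_eq_single i, Finsupp.single_apply]
      · intro j _ hji
        refine Finsupp.single_eq_of_ne fun h => ?_
        exact disjoint_left.1 (hV hji) (hx j) (h ▸ hz)
      · simp
    have hxx : x = x' := by
      funext i
      have h1 := key x l hx i (x i) (hx i)
      have h2 := key x' l' hx' i (x i) (hx i)
      rw [← hy, hy', h2, if_pos rfl] at h1
      by_contra hne
      rw [if_neg (Ne.symm hne)] at h1
      exact hK0 n _ (hl i) h1.symm
    subst hxx
    have hll : l = l' := by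
      funext i
      have h1 := key x l hx i (x i) (hx i)
      have h2 := key x l' hx' i (x i) (hx i)
      rw [← hy, hy', h2, if_pos rfl, if_pos rfl] at h1
      exact h1.symm
    subst hll
    rfl
  have hemb : ∀ j, Topology.IsClosedEmbedding fun p : A j => p.1.1 := fun j => by
    have : CompactSpace (A j) := isCompact_iff_compactSpace.1 (hAc j)
    exact (continuous_fst.comp continuous_subtype_val).isClosedEmbedding (hinj j)
  refine totallyDisconnectedSpace_of_iUnion (D := fun j : I => range fun p : A j => p.1.1)
    (fun j => (hemb j).isClosed_range) (fun j => ?_) ?_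
  · rw [(hemb j).isEmbedding.isTotallyDisconnected_range]
    refine ⟨fun t _ ht => ?_⟩
    have hx : ((fun p : A j => p.1.2.1) '' t).Subsingleton := IsPreconnected.subsingleton
      (ht.image _ (by fun_prop))
    rcases t.eq_empty_or_nonempty with rfl | ⟨p₀, hp₀⟩
    · exact subsingleton_empty
    let S := Submodule.span ℝ (range fun i => Finsupp.single (p₀.1.2.1 i) (1 : ℝ))
    have : FiniteDimensional ℝ S := FiniteDimensional.span_of_finite ℝ (finite_range _)
    have hfin : {y | φ y ∈ S}.Finite := by
      have hli' : LinearIndependent ℝ fun y : {y | φ y ∈ S} => (⟨φ y, y.2⟩ : S) :=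
        LinearIndependent.of_comp S.subtype (hli.comp _ Subtype.val_injective)
      exact hli'.finite
    have himg : ((fun p : A j => p.1.1) '' t) ⊆ {y | φ y ∈ S} := by
      rintro _ ⟨p, hp, rfl⟩
      have hpx : p.1.2.1 = p₀.1.2.1 := hx ⟨p, hp, rfl⟩ ⟨p₀, hp₀, rfl⟩
      have hpφ := p.2.2.2
      simp only [mem_ofPred_eq, hpφ, hpx]
      refine Submodule.sum_mem _ fun i _ => ?_
      rw [← mul_one (p.1.2.2 i), ← smul_eq_mul, ← Finsupp.smul_single]
      exact S.smul_mem _ (Submodule.subset_span ⟨i, rfl⟩)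
    have := hfin.countable.isTotallyDisconnected _ himg (ht.image _ (by fun_prop))
    exact fun a ha b hb => hinj j (this ⟨a, ha, rfl⟩ ⟨b, hb, rfl⟩)
  · refine eq_univ_of_forall fun y => mem_iUnion.2 ?_
    let s := (φ y).support
    let x : Fin s.card → X := fun i => s.equivFin.symm i
    have hxinj : Function.Injective x :=
      Subtype.val_injective.comp s.equivFin.symm.injective
    obtain ⟨U, hU, hUd⟩ := s.finite_toSet.t2_separation
    choose V hV hxV hVU using fun i : Fin s.card =>
      compact_exists_isClopen_in_isOpen (hU (x i)).2 (hU (x i)).1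
    have hx0 : ∀ i, φ y (x i) ≠ 0 := fun i =>
      Finsupp.mem_support_iff.1 (s.equivFin.symm i).2
    have hn : ∃ n : ℕ, ∀ i, φ y (x i) ∈ K n := by
      have : ∀ i, ∀ᶠ n : ℕ in Filter.atTop, φ y (x i) ∈ K n := fun i => by
        refine (tendsto_one_div_add_atTop_nhds_zero_nat.eventually_le_const
          (abs_pos.2 (hx0 i))).and ?_
        filter_upwards [Filter.eventually_ge_atTop ⌈|φ y (x i)|⌉₊] with n hn
        exact (Nat.ceil_le.1 hn).trans (by linarith)
      exact (Filter.eventually_all.2 this).exists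
    obtain ⟨n, hn⟩ := hn
    refine ⟨⟨⟨s.card, fun i => ⟨V i, hV i⟩, fun i j hij => ?_⟩, n⟩,
      ⟨⟨y, x, fun i => φ y (x i)⟩, ?_, ?_, ?_⟩, rfl⟩
    · exact (hUd (s.equivFin.symm i).2 (s.equivFin.symm j).2 (hxinj.ne hij)).mono
        (hVU i) (hVU j)
    · exact fun i _ => hxV i
    · exact fun i _ => hn i
    · have h1 := (φ y).sum_single
      rw [Finsupp.sum, ← Finset.sum_coe_sort] at h1
      conv_lhs => rw [← h1]
      exact (Equiv.sum_comp s.equivFin.symm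
        fun z : s => Finsupp.single (z : X) (φ y z)).symm

/-- A finitely supported measure annihilating a dense subspace of `Cp X` vanishes. -/
theorem Cp.eq_zero_of_dense {X : Type*} [TopologicalSpace X] [T4Space X]
    {E : Submodule ℝ (Cp X)} (hE : Dense (E : Set (Cp X))) (c : X →₀ ℝ)
    (h : ∀ f : E, Finsupp.linearCombination ℝ ((f : Cp X) : X → ℝ) c = 0) : c = 0 := by
  classical
  have hcont : Continuous fun f : Cp X => Finsupp.linearCombination ℝ (f : X → ℝ) c := by
    simp only [Finsupp.linearCombination_apply, Finsupp.sum]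
    exact continuous_finsetSum _ fun x _ =>
      ((continuous_apply x).comp continuous_subtype_val).const_smul (c x)
  have hall : ∀ f : Cp X, Finsupp.linearCombination ℝ (f : X → ℝ) c = 0 :=
    congrFun (hcont.ext_on hE continuous_const fun f hf => h ⟨f, hf⟩)
  ext x
  obtain ⟨f, hf0, hf1, -⟩ := exists_continuous_zero_one_of_isClosed
    (s := (c.support.erase x : Set X)) (t := {x}) (Finset.finite_toSet _).isClosed
    isClosed_singleton (by simp)
  have hfx := hall ⟨f, f.continuous⟩
  rw [Finsupp.linearCombination_apply, Finsupp.sum, Finset.sum_eq_single x] at hfx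
  · simpa [hf1 (Set.mem_singleton x)] using hfx
  · intro z hz hzx
    simp [hf0 (Finset.mem_coe.2 (Finset.mem_erase.2 ⟨hzx, hz⟩))]
  · intro hx
    simp [Finsupp.notMem_support_iff.1 hx]

/-- If the topology of `V` is induced by a family of linear functionals, then every continuous
linear functional on `V` is a finite linear combination of members of the family. -/
theorem ContinuousLinearMap.exists_finsupp_of_isInducing {V X : Type*} [AddCommGroup V]
    [Module ℝ V] [TopologicalSpace V] (ev : X → V →ₗ[ℝ] ℝ)
    (hev : Topology.IsInducing fun (v : V) (x : X) => ev x v) (φ : V →L[ℝ] ℝ) :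
    ∃ c : X →₀ ℝ, ∀ v, φ v = Finsupp.linearCombination ℝ (fun x => ev x v) c := by
  have hmem : (φ : V →ₗ[ℝ] ℝ) ∈ Submodule.span ℝ (Set.range ev) := by
    rw [LinearMap.mem_span_iff_continuous, continuous_iff_le_induced, ← induced_to_pi,
      ← hev.eq_induced]
    exact φ.continuous.le_induced
  obtain ⟨c, hc⟩ := Finsupp.mem_span_range_iff_exists_finsupp.1 hmem
  refine ⟨c, fun v => ?_⟩
  have := LinearMap.congr_fun hc v
  rw [Finsupp.linearCombination_apply]
  simpa [Finsupp.sum] using this.symm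

/-- Continuous linear functionals on a subspace of `Cp X` are represented by finitely supported
measures. -/
theorem Cp.exists_linearCombination {X : Type*} [TopologicalSpace X]
    (E : Submodule ℝ (Cp X)) (φ : E →L[ℝ] ℝ) :
    ∃ c : X →₀ ℝ, ∀ f : E, φ f = Finsupp.linearCombination ℝ ((f : Cp X) : X → ℝ) c :=
  ContinuousLinearMap.exists_finsupp_of_isInducing (V := E)
    (fun x : X =>
      { toFun := fun f => (f : Cp X).1 x, map_add' := fun _ _ => rfl, map_smul' := fun _ _ => rfl })
    (Topology.IsInducing.subtypeVal.comp Topology.IsInducing.subtypeVal) φ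

/-- Let `X` and `Y` be compact metrizable spaces, `E` a dense linear subspace of `C_p(X)`,
`F` a dense linear subspace of `C_p(Y)`, and `T : E → F` a surjective continuous linear
map. If `X` is totally disconnected, then so is `Y`. -/
theorem stmt1 (X Y : Type) [TopologicalSpace X] [TopologicalSpace Y]
    [CompactSpace X] [TopologicalSpace.MetrizableSpace X]
    [CompactSpace Y] [TopologicalSpace.MetrizableSpace Y]
    (E : Submodule ℝ ↥(Cp X)) (hE : Dense (E : Set ↥(Cp X)))
    (F : Submodule ℝ ↥(Cp Y)) (hF : Dense (F : Set ↥(Cp Y)))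
    (T : ↥E →L[ℝ] ↥F) (hT : Function.Surjective T)
    (hX : TotallyDisconnectedSpace X) : TotallyDisconnectedSpace Y := by
  let δ : Y → F →L[ℝ] ℝ := fun y =>
    (ContinuousLinearMap.proj y).comp ((Cp Y).subtypeL.comp F.subtypeL)
  choose φ hφ using fun y => Cp.exists_linearCombination E ((δ y).comp T)
  have hφ' : ∀ (f : E) (y : Y), Finsupp.linearCombination ℝ ((f : Cp X) : X → ℝ) (φ y) =
      ((T f : Cp Y) : Y → ℝ) y := fun f y => (hφ y f).symm
  refine totallyDisconnectedSpace_of_linearIndependent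
    (fun f : E => ((f : Cp X) : X → ℝ)) (fun f => f.1.2) (Cp.eq_zero_of_dense hE) φ
    (fun f => ?_) (linearIndependent_iff.2 fun d hd => Cp.eq_zero_of_dense hF d fun g => ?_)
  · simp only [hφ']
    exact (T f).1.2
  · obtain ⟨f, rfl⟩ := hT g
    rw [Finsupp.linearCombination_apply] at hd ⊢
    have := congrArg (Finsupp.linearCombination ℝ ((f : Cp X) : X → ℝ)) hd
    simpa [Finsupp.sum, map_sum, hφ'] using this
end

section
/- Let X be a completely regular Hausdorff (Tychonoff) space which is pseudocompact (every continuous function X → ℝ is bounded) and whose Stone–Čech compactification βX is totally disconnected, and let Y be a compact Hausdorff space. If there exists a surjective continuous linear map T : C_p(X) → C_p(Y), then Y is totally disconnected. -/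
open Set Filter Topology

/-- In a nontrivial continuum, every nonempty open set contains a nondegenerate connected set. -/
theorem exists_isPreconnected_nontrivial_subset_of_isOpen {Y : Type*} [TopologicalSpace Y]
    [CompactSpace Y] [T2Space Y] [PreconnectedSpace Y] [Nontrivial Y] {U : Set Y}
    (hU : IsOpen U) (hne : U.Nonempty) :
    ∃ D ⊆ U, IsPreconnected D ∧ D.Nontrivial := by
  by_contra! hD
  obtain ⟨y₀, hy₀⟩ := hne
  obtain ⟨y₁, hy₁⟩ := exists_ne y₀
  obtain ⟨K, hK, hyK, hKU⟩ :=
    exists_compact_subset (hU.sdiff (isClosed_singleton (x := y₁))) ⟨hy₀, hy₁.symm⟩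
  have : CompactSpace K := isCompact_iff_compactSpace.mp hK
  have : TotallyDisconnectedSpace K := by
    rw [totallyDisconnectedSpace_subtype_iff]
    intro t htK ht
    exact hD t (fun y hy ↦ (hKU (htK hy)).1) ht
  obtain ⟨V, hV, hyV, hVK⟩ := compact_exists_isClopen_in_isOpen
    (isOpen_interior.preimage (continuous_subtype_val (p := (· ∈ K))))
    (x := ⟨y₀, interior_subset hyK⟩) hyK
  obtain ⟨W, hW, rfl⟩ := isOpen_induced_iff.mp hV.isOpen
  have himage : Subtype.val '' (Subtype.val ⁻¹' W : Set K) = W ∩ interior K := by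
    ext y
    constructor
    · rintro ⟨z, hz, rfl⟩
      exact ⟨hz, hVK hz⟩
    · exact fun h ↦ ⟨⟨y, interior_subset h.2⟩, h.1, rfl⟩
  have hclopen : IsClopen (W ∩ interior K) :=
    ⟨himage ▸ hK.isClosed.isClosedMap_subtype_val _ hV.isClosed, hW.inter isOpen_interior⟩
  have huniv := hclopen.eq_univ ⟨y₀, hyV, hyK⟩
  have hmem : y₁ ∈ W ∩ interior K := huniv ▸ mem_univ y₁
  exact (hKU (interior_subset hmem.2)).2 rfl

/-- In a completely regular Hausdorff space, a point can be separated from the complement of an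
open set containing it by a continuous real-valued function. -/
theorem exists_continuous_eq_one_eq_zero {X : Type*} [TopologicalSpace X] [CompletelyRegularSpace X]
    {V : Set X} (hV : IsOpen V) {x : X} (hx : x ∈ V) :
    ∃ f : X → ℝ, Continuous f ∧ f x = 1 ∧ ∀ z ∉ V, f z = 0 := by
  obtain ⟨f, hf, hfx, hfV⟩ := CompletelyRegularSpace.completely_regular_isOpen x V hV hx
  refine ⟨fun z ↦ 1 - f z, by fun_prop, by simp [hfx], fun z hz ↦ ?_⟩
  simp [hfV hz]

/-- In a Tychonoff space, a point can be separated simultaneously from the complement of an open set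
containing it and from finitely many other points. -/
theorem exists_continuous_eq_one_eq_zero_finset {X : Type*} [TopologicalSpace X] [T35Space X]
    {V : Set X} (hV : IsOpen V) {x : X} (hx : x ∈ V) (s : Finset X) :
    ∃ f : X → ℝ, Continuous f ∧ f x = 1 ∧ (∀ z ∉ V, f z = 0) ∧ ∀ z ∈ s, z ≠ x → f z = 0 := by
  classical
  obtain ⟨f, hf, hfx, hfV⟩ := exists_continuous_eq_one_eq_zero
    (hV.sdiff (s.erase x).finite_toSet.isClosed) (x := x) ⟨hx, by simp⟩
  exact ⟨f, hf, hfx, fun z hz ↦ hfV z fun h ↦ hz h.1,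
    fun z hz hzx ↦ hfV z fun h ↦ h.2 (by simp [hz, hzx])⟩

/-- The supports of a weak-* continuous family of finitely supported measures vary lower
semicontinuously. -/
theorem eventually_support_inter_nonempty {X Y : Type*} [TopologicalSpace X] [T35Space X]
    [TopologicalSpace Y] {μ : Y → X →₀ ℝ}
    (hμ : ∀ f : X → ℝ, Continuous f → Continuous fun y ↦ Finsupp.linearCombination ℝ f (μ y))
    {V : Set X} (hV : IsOpen V) {x : X} (hx : x ∈ V) {y : Y} (hxy : x ∈ (μ y).support) :
    ∀ᶠ y' in 𝓝 y, ∃ z ∈ (μ y').support, z ∈ V := by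
  obtain ⟨f, hf, hfx, hfV, hfs⟩ := exists_continuous_eq_one_eq_zero_finset hV hx (μ y).support
  have hne : Finsupp.linearCombination ℝ f (μ y) ≠ 0 := by
    rw [Finsupp.linearCombination_apply, Finsupp.sum, Finset.sum_eq_single x]
    · simpa [hfx] using hxy
    · intro z hz hzx
      simp [hfs z hz hzx]
    · exact fun h ↦ absurd hxy h
  filter_upwards [(hμ f hf).continuousAt.eventually_ne hne] with y' hy'
  by_contra! h
  refine hy' ?_
  rw [Finsupp.linearCombination_apply, Finsupp.sum]
  exact Finset.sum_eq_zero fun z hz ↦ by simp [hfV z (h z hz)]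

/-- Around a support, one can choose disjoint open sets all of which meet the supports of
nearby measures. -/
theorem exists_disjoint_isOpen_eventually_support {X Y : Type*} [TopologicalSpace X] [T35Space X]
    [TopologicalSpace Y] {μ : Y → X →₀ ℝ}
    (hμ : ∀ f : X → ℝ, Continuous f → Continuous fun y ↦ Finsupp.linearCombination ℝ f (μ y))
    (y : Y) :
    ∃ V : X → Set X, (∀ x, IsOpen (V x)) ∧ ((μ y).support : Set X).PairwiseDisjoint V ∧
      ∀ᶠ y' in 𝓝 y, ∀ x ∈ (μ y).support, ∃ z ∈ (μ y').support, z ∈ V x := by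
  obtain ⟨V, hV, hdisj⟩ := (μ y).support.finite_toSet.t2_separation
  refine ⟨V, fun x ↦ (hV x).2, hdisj, ?_⟩
  rw [Filter.eventually_all_finset]
  exact fun x hx ↦ eventually_support_inter_nonempty hμ (hV x).2 (hV x).1 hx

/-- If `g` selects from `t` a point of each of the disjoint sets `V x`, `x ∈ s`, then `g` is
injective on `s`. -/
theorem injOn_of_mem_pairwiseDisjoint {X : Type*} {V : X → Set X} {s : Set X}
    (hV : s.PairwiseDisjoint V) {g : X → X} (hg : ∀ x ∈ s, g x ∈ V x) : InjOn g s := by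
  intro a ha b hb hab
  by_contra hne
  exact disjoint_left.mp (hV ha hb hne) (hg a ha) (hab ▸ hg b hb)

/-- The set of points whose measure is supported by at most `n` points is closed. -/
theorem isClosed_card_support_le {X Y : Type*} [TopologicalSpace X] [T35Space X]
    [TopologicalSpace Y] {μ : Y → X →₀ ℝ}
    (hμ : ∀ f : X → ℝ, Continuous f → Continuous fun y ↦ Finsupp.linearCombination ℝ f (μ y))
    (n : ℕ) : IsClosed {y | (μ y).support.card ≤ n} := by
  rw [← isOpen_compl_iff, isOpen_iff_mem_nhds]
  intro y hy
  obtain ⟨V, -, hdisj, hev⟩ := exists_disjoint_isOpen_eventually_support hμ y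
  filter_upwards [hev] with y' hy'
  choose! g hg hgV using hy'
  have := Finset.card_le_card_of_injOn g hg (injOn_of_mem_pairwiseDisjoint hdisj hgV)
  simp only [mem_compl_iff, mem_ofPred_eq, not_le] at hy ⊢
  omega

/-- A weak-* continuous family of finitely supported measures on a totally disconnected space,
indexed by a nontrivial continuum, is linearly dependent. -/
theorem not_linearIndependent_of_continuum {X Y : Type*} [TopologicalSpace X] [T35Space X]
    [TotallyDisconnectedSpace X] [TopologicalSpace Y] [CompactSpace Y] [T2Space Y]
    [PreconnectedSpace Y] [Nontrivial Y] {μ : Y → X →₀ ℝ}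
    (hμ : ∀ f : X → ℝ, Continuous f → Continuous fun y ↦ Finsupp.linearCombination ℝ f (μ y)) :
    ¬ LinearIndependent ℝ μ := by
  classical
  intro hli
  obtain ⟨n, hn⟩ := nonempty_interior_of_iUnion_of_closed (isClosed_card_support_le hμ)
    (iUnion_eq_univ_iff.mpr fun y ↦ ⟨(μ y).support.card, le_refl (μ y).support.card⟩)
  set U := interior {y | (μ y).support.card ≤ n}
  obtain ⟨y₀, hy₀, hmax⟩ : ∃ y₀ ∈ U, ∀ y ∈ U, (μ y).support.card ≤ (μ y₀).support.card := by
    have hbdd : BddAbove ((fun y ↦ (μ y).support.card) '' U) := by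
      refine ⟨n, ?_⟩
      rintro _ ⟨y, hy, rfl⟩
      exact interior_subset (s := {y | (μ y).support.card ≤ n}) hy
    obtain ⟨y₀, hy₀, h⟩ := Nat.sSup_mem (hn.image _) hbdd
    exact ⟨y₀, hy₀, fun y hy ↦ (le_csSup hbdd ⟨y, hy, rfl⟩).trans_eq h.symm⟩
  obtain ⟨V, hV, hdisj, hev⟩ := exists_disjoint_isOpen_eventually_support hμ y₀
  obtain ⟨N, hN, hNo, hyN⟩ := eventually_nhds_iff.mp
    (hev.and (isOpen_interior.eventually_mem hy₀))
  obtain ⟨D, hDN, hD, hDnt⟩ :=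
    exists_isPreconnected_nontrivial_subset_of_isOpen hNo ⟨y₀, hyN⟩
  have hsel : ∀ y ∈ N, ∀ x ∈ (μ y₀).support, ∃ z ∈ (μ y).support, z ∈ V x :=
    fun y hy ↦ (hN y hy).1
  choose! g hg hgV using hsel
  have hsupp : ∀ y ∈ N, (μ y₀).support.image (g y) = (μ y).support := by
    intro y hy
    refine Finset.eq_of_subset_of_card_le (Finset.image_subset_iff.mpr (hg y hy)) ?_
    rw [Finset.card_image_of_injOn (injOn_of_mem_pairwiseDisjoint hdisj (hgV y hy))]
    exact hmax y (hN y hy).2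
  have huniq : ∀ y ∈ N, ∀ x ∈ (μ y₀).support, ∀ z ∈ (μ y).support, z ∈ V x → z = g y x := by
    intro y hy x hx z hz hzV
    rw [← hsupp y hy, Finset.mem_image] at hz
    obtain ⟨x', hx', rfl⟩ := hz
    by_contra hne
    exact disjoint_left.mp (hdisj hx' hx fun h ↦ hne (by rw [h])) (hgV y hy x' hx') hzV
  have hcont : ∀ x ∈ (μ y₀).support, ContinuousOn (fun y ↦ g y x) D := by
    intro x hx y hy
    refine ContinuousAt.continuousWithinAt ?_
    rw [ContinuousAt, tendsto_nhds]
    intro W hW hgW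
    have hyN' := hDN hy
    filter_upwards [hNo.mem_nhds hyN', eventually_support_inter_nonempty hμ (hW.inter (hV x))
      ⟨hgW, hgV y hyN' x hx⟩ (hg y hyN' x hx)] with y' hy' hz
    obtain ⟨z, hz, hzW, hzV⟩ := hz
    obtain rfl := huniq y' hy' x hx z hz hzV
    exact hzW
  obtain ⟨d, hd⟩ := hDnt.nonempty
  have hconst : ∀ y ∈ D, (μ y).support = (μ d).support := by
    intro y hy
    rw [← hsupp y (hDN hy), ← hsupp d (hDN hd)]
    refine Finset.image_congr fun x hx ↦ ?_
    exact (hD.image _ (hcont x hx)).subsingleton ⟨y, hy, rfl⟩ ⟨d, hd, rfl⟩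
  have : Finite D := by
    refine (hli.comp ((↑) : D → Y) Subtype.val_injective).finite_of_le_span_finite _
      ((fun x ↦ Finsupp.single x (1 : ℝ)) '' ((μ d).support : Set X)) ?_
    rintro _ ⟨y, rfl⟩
    rw [SetLike.mem_coe, ← Finsupp.supported_eq_span_single, Finsupp.mem_supported]
    exact (congrArg _ (hconst y y.2)).le
  exact hD.infinite_of_nontrivial hDnt (toFinite D)

/-- A continuous linear functional on `Cp X` is a finite linear combination of evaluations. -/
theorem exists_finsupp_linearCombination_eq {X : Type*} [TopologicalSpace X]
    (φ : ↥(Cp X) →L[ℝ] ℝ) :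
    ∃ μ : X →₀ ℝ, ∀ f : ↥(Cp X), φ f = Finsupp.linearCombination ℝ (f : X → ℝ) μ := by
  let ev : X → ↥(Cp X) →ₗ[ℝ] ℝ := fun x ↦ LinearMap.proj x ∘ₗ (Cp X).subtype
  have hmem : (φ : ↥(Cp X) →ₗ[ℝ] ℝ) ∈ Submodule.span ℝ (range ev) := by
    rw [LinearMap.mem_span_iff_continuous]
    convert φ.continuous using 1
    · change _ = TopologicalSpace.induced Subtype.val (⨅ x, TopologicalSpace.induced _ _)
      rw [induced_iInf]
      simp only [induced_compose]
      rfl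
    · rfl
  obtain ⟨μ, hμ⟩ := Finsupp.mem_span_range_iff_exists_finsupp.mp hmem
  refine ⟨μ, fun f ↦ ?_⟩
  have := LinearMap.congr_fun hμ f
  simpa [Finsupp.sum, Finsupp.linearCombination_apply, ev] using this.symm

/-- Let `X` be a pseudocompact Tychonoff space whose Stone–Čech compactification is
totally disconnected, and let `Y` be a compact Hausdorff space. If there is a surjective
continuous linear map `C_p(X) → C_p(Y)`, then `Y` is totally disconnected. -/
theorem stmt4 (X Y : Type) [TopologicalSpace X] [T35Space X]
    (hpc : ∀ f : X → ℝ, Continuous f → ∃ M : ℝ, ∀ x : X, |f x| ≤ M)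
    (hβX : TotallyDisconnectedSpace (StoneCech X))
    [TopologicalSpace Y] [CompactSpace Y] [T2Space Y]
    (T : ↥(Cp X) →L[ℝ] ↥(Cp Y)) (hT : Function.Surjective T) :
    TotallyDisconnectedSpace Y := by
  have hX : TotallyDisconnectedSpace X := by
    refine ⟨fun t _ ht a ha b hb ↦ injective_stoneCechUnit_of_t35Space ?_⟩
    exact (ht.image _ continuous_stoneCechUnit.continuousOn).subsingleton
      ⟨a, ha, rfl⟩ ⟨b, hb, rfl⟩
  have hrep : ∀ y : Y, ∃ μ : X →₀ ℝ, ∀ f : ↥(Cp X),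
      (T f : Y → ℝ) y = Finsupp.linearCombination ℝ (f : X → ℝ) μ := fun y ↦
    exists_finsupp_linearCombination_eq
      ((ContinuousLinearMap.proj (R := ℝ) (φ := fun _ : Y ↦ ℝ) y).comp
        ((Cp Y).subtypeL.comp T))
  choose μ hμ using hrep
  have hcont : ∀ f : X → ℝ, Continuous f →
      Continuous fun y ↦ Finsupp.linearCombination ℝ f (μ y) := by
    intro f hf
    simp_rw [← hμ _ ⟨f, hf⟩]
    exact (T ⟨f, hf⟩).2
  have hli : LinearIndependent ℝ μ := by
    rw [linearIndependent_iff]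
    intro l hl
    ext y
    obtain ⟨g, hg, hgy, -, hgl⟩ :=
      exists_continuous_eq_one_eq_zero_finset isOpen_univ (mem_univ y) l.support
    obtain ⟨f, hf⟩ := hT ⟨g, hg⟩
    have hzero := congrArg (Finsupp.linearCombination ℝ (f : X → ℝ)) hl
    rw [Finsupp.linearCombination_apply ℝ l, map_finsuppSum, map_zero] at hzero
    simp only [map_smul, ← hμ, hf] at hzero
    rw [Finsupp.sum, Finset.sum_eq_single y (fun z hz hzy ↦ by simp [hgl z hz hzy])
      (fun h ↦ by simp [Finsupp.notMem_support_iff.mp h])] at hzero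
    simpa [hgy] using hzero
  rw [totallyDisconnectedSpace_iff_connectedComponent_subsingleton]
  intro y
  by_contra hns
  have hnt := not_subsingleton_iff.mp hns
  have : Nontrivial (connectedComponent y) := hnt.coe_sort
  have : CompactSpace (connectedComponent y) :=
    isCompact_iff_compactSpace.mp isClosed_connectedComponent.isCompact
  have : PreconnectedSpace (connectedComponent y) :=
    isPreconnected_iff_preconnectedSpace.mp isPreconnected_connectedComponent
  exact not_linearIndependent_of_continuum (μ := fun z : connectedComponent y ↦ μ z)
    (fun f hf ↦ (hcont f hf).comp continuous_subtype_val)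
    (hli.comp _ Subtype.val_injective)
end

section
/- There exist a subset C′ of the Cantor space (ℕ → Bool) which is the complement of a countable set (in particular a Gδ subset, hence a Polish space with the subspace topology), a dense linear subspace E of C_p(C′), and a surjective continuous linear map T : E → C_p([0,1]). -/
open Real in
/-- The two extreme values of a binary expansion are attained only at constant sequences. -/
theorem digit_eq_of_ofDigits_eq (c : Fin 2) (n : ℕ) (a : ℕ → Fin 2)
    (h : ofDigits a = (c : ℕ)) : a n = c := by
  induction n generalizing a with
  | zero =>
    have h1 := ofDigits_eq_sum_add_ofDigits a 1
    have h2 := ofDigits_nonneg (fun i ↦ a (i + 1))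
    have h3 := ofDigits_le_one (fun i ↦ a (i + 1))
    rw [h] at h1
    simp only [Finset.range_one, Finset.sum_singleton, ofDigitsTerm] at h1
    generalize a 0 = d at *
    fin_cases c <;> fin_cases d <;> first | rfl | (norm_num at h1; linarith)
  | succ n ih =>
    refine ih (fun i ↦ a (i + 1)) ?_
    have h1 := ofDigits_eq_sum_add_ofDigits a 1
    have h2 := ofDigits_nonneg (fun i ↦ a (i + 1))
    have h3 := ofDigits_le_one (fun i ↦ a (i + 1))
    rw [h] at h1
    simp only [Finset.range_one, Finset.sum_singleton, ofDigitsTerm] at h1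
    generalize a 0 = d at *
    fin_cases c <;> fin_cases d <;> norm_num at h1 ⊢ <;> linarith

open Real in
/-- Two distinct binary expansions of the same real number are eventually constant. -/
theorem eventually_const_of_ofDigits_eq {a b : ℕ → Fin 2} (h : ofDigits a = ofDigits b)
    (hab : a ≠ b) : ∃ n c, ∀ m, n ≤ m → a m = c := by
  classical
  have hex : ∃ n, a n ≠ b n := Function.ne_iff.mp hab
  set n := Nat.find hex
  have hn : a n ≠ b n := Nat.find_spec hex
  have hlt : ∀ i < n, a i = b i := fun i hi ↦ not_not.mp (Nat.find_min hex hi)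
  have key : ofDigits (fun i ↦ a (i + n)) = ofDigits (fun i ↦ b (i + n)) := by
    rw [ofDigits_eq_sum_add_ofDigits a n, ofDigits_eq_sum_add_ofDigits b n] at h
    have hs : ∑ i ∈ Finset.range n, ofDigitsTerm a i = ∑ i ∈ Finset.range n, ofDigitsTerm b i :=
      Finset.sum_congr rfl fun i hi ↦ by
        simp only [ofDigitsTerm, hlt i (Finset.mem_range.mp hi)]
    rw [hs] at h
    simpa using h
  rw [ofDigits_eq_sum_add_ofDigits (fun i ↦ a (i + n)) 1,
    ofDigits_eq_sum_add_ofDigits (fun i ↦ b (i + n)) 1] at key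
  simp only [Finset.range_one, Finset.sum_singleton, ofDigitsTerm, zero_add] at key
  have ha0 := ofDigits_nonneg (fun i ↦ a (i + 1 + n))
  have ha1 := ofDigits_le_one (fun i ↦ a (i + 1 + n))
  have hb0 := ofDigits_nonneg (fun i ↦ b (i + 1 + n))
  have hb1 := ofDigits_le_one (fun i ↦ b (i + 1 + n))
  have hc : ∃ c : Fin 2, ofDigits (fun i ↦ a (i + 1 + n)) = (c : ℕ) := by
    generalize a n = d at *
    generalize b n = e at *
    fin_cases d <;> fin_cases e
    · simp at hn
    · refine ⟨1, ?_⟩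
      norm_num at key ⊢
      linarith
    · refine ⟨0, ?_⟩
      norm_num at key ⊢
      linarith
    · simp at hn
  obtain ⟨c, hc⟩ := hc
  refine ⟨n + 1, c, fun m hm ↦ ?_⟩
  obtain ⟨k, rfl⟩ := Nat.exists_eq_add_of_le' hm
  have := digit_eq_of_ofDigits_eq c k _ hc
  rwa [add_assoc, add_comm 1 n] at this

theorem countable_setOf_eventually_const (α : Type*) [Countable α] :
    {x : ℕ → α | ∃ n c, ∀ m, n ≤ m → x m = c}.Countable := by
  have : {x : ℕ → α | ∃ n c, ∀ m, n ≤ m → x m = c} ⊆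
      ⋃ n : ℕ, Set.range fun p : (Fin n → α) × α ↦
        fun m : ℕ ↦ if h : m < n then p.1 ⟨m, h⟩ else p.2 := by
    rintro x ⟨n, c, hx⟩
    refine Set.mem_iUnion.mpr ⟨n, (fun i : Fin n ↦ x i, c), ?_⟩
    funext m
    by_cases h : m < n
    · simp [h]
    · simp [h, hx m (not_lt.mp h)]
  exact (Set.countable_iUnion fun n ↦ Set.countable_range _).mono this

/-- A surjection whose nontrivial fibres have countable union becomes bijective after
removing a countable set. -/
theorem exists_countable_compl_bijective {X Y : Type*} {φ : X → Y} (hφ : φ.Surjective)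
    (h : {x | ∃ y, y ≠ x ∧ φ y = φ x}.Countable) :
    ∃ D : Set X, D.Countable ∧ Function.Bijective fun x : ↥Dᶜ ↦ φ x := by
  obtain ⟨s, hs⟩ := hφ.hasRightInverse
  refine ⟨{x | s (φ x) ≠ x}, h.mono ?_, ?_, fun t ↦ ?_⟩
  · intro x hx
    exact ⟨s (φ x), hx, hs _⟩
  · rintro ⟨x, hx⟩ ⟨y, hy⟩ hxy
    exact Subtype.ext ((not_not.mp hx).symm.trans ((congrArg s hxy).trans (not_not.mp hy)))
  · exact ⟨⟨s t, by simp [hs t]⟩, hs t⟩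

open Real in
theorem exists_countable_compl_bijective_fromBinary :
    ∃ D : Set (ℕ → Bool), D.Countable ∧ Function.Bijective fun x : ↥Dᶜ ↦ fromBinary x := by
  refine exists_countable_compl_bijective fromBinary_surjective
    ((countable_setOf_eventually_const Bool).mono ?_)
  rintro x ⟨y, hne, hxy⟩
  have h : ofDigits (fun i ↦ finTwoEquiv.symm (x i)) = ofDigits (fun i ↦ finTwoEquiv.symm (y i)) :=
    (congrArg Subtype.val hxy).symm
  obtain ⟨n, c, hc⟩ := eventually_const_of_ofDigits_eq h fun hxy' ↦
    hne (funext fun i ↦ (finTwoEquiv.symm.injective (congrFun hxy' i)).symm)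
  exact ⟨n, finTwoEquiv c, fun m hm ↦ (finTwoEquiv.symm_apply_eq).mp (hc m hm)⟩

/-- Precomposition with a continuous map, as a linear map between function spaces. -/
def Cp.comap {X Y : Type*} [TopologicalSpace X] [TopologicalSpace Y] (φ : X → Y)
    (hφ : Continuous φ) : Cp Y →ₗ[ℝ] Cp X where
  toFun g := ⟨fun x ↦ g.1 (φ x), g.2.comp hφ⟩
  map_add' _ _ := rfl
  map_smul' _ _ := rfl

/-- Precomposition with an injective continuous map into `[0,1]` has dense range. -/
theorem Cp.denseRange_comap {X : Type*} [TopologicalSpace X] {φ : X → unitInterval}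
    (hφ : Continuous φ) (hinj : Function.Injective φ) : DenseRange (Cp.comap φ hφ) := by
  intro f
  rw [mem_closure_iff_nhds]
  intro U hU
  rw [nhds_subtype_eq_comap, Filter.mem_comap] at hU
  obtain ⟨V, hV, hVU⟩ := hU
  obtain ⟨W, hWV, hW, hfW⟩ := mem_nhds_iff.mp hV
  obtain ⟨s, u, hu, hsu⟩ := isOpen_pi_iff.mp hW _ hfW
  classical
  have hv : Set.InjOn (fun x ↦ (φ x : ℝ)) (s : Set X) :=
    (Subtype.val_injective.comp hinj).injOn
  let p := Lagrange.interpolate s (fun x ↦ (φ x : ℝ)) f.1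
  let g : Cp unitInterval := ⟨fun t ↦ p.eval (t : ℝ), by
    exact p.continuous.comp continuous_subtype_val⟩
  refine ⟨Cp.comap φ hφ g, hVU (hWV (hsu fun x hx ↦ ?_)), g, rfl⟩
  have : (Cp.comap φ hφ g).1 x = f.1 x := Lagrange.eval_interpolate_at_node f.1 hv hx
  rw [this]
  exact (hu x hx).2

/-- Precomposition with a continuous surjection has a continuous linear left inverse, defined on
its range. -/
theorem Cp.exists_leftInverse_comap {X Y : Type*} [TopologicalSpace X] [TopologicalSpace Y]
    {φ : X → Y} (hφ : Continuous φ) (hsurj : Function.Surjective φ) :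
    ∃ T : LinearMap.range (Cp.comap φ hφ) →L[ℝ] Cp Y,
      ∀ g, T ⟨Cp.comap φ hφ g, g, rfl⟩ = g := by
  have hinj : Function.Injective (Cp.comap φ hφ) := fun g₁ g₂ h ↦ Subtype.ext <| funext fun y ↦ by
    obtain ⟨x, rfl⟩ := hsurj y
    exact congrFun (congrArg Subtype.val h) x
  let e := LinearEquiv.ofInjective (Cp.comap φ hφ) hinj
  refine ⟨⟨e.symm.toLinearMap, ?_⟩, fun g ↦ e.symm_apply_apply g⟩
  refine Continuous.subtype_mk (continuous_pi fun y ↦ ?_) _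
  obtain ⟨x, rfl⟩ := hsurj y
  have h : ∀ f, (e.symm f).1 (φ x) = f.1.1 x := fun f ↦
    congrFun (congrArg (fun z ↦ z.1.1) (e.apply_symm_apply f)) x
  exact (((continuous_apply x).comp continuous_subtype_val).comp continuous_subtype_val).congr
    fun f ↦ (h f).symm

/-- There exist a co-countable subset `C' = Dᶜ` of the Cantor space `ℕ → Bool`, a dense
linear subspace `E` of `C_p(C')`, and a surjective continuous linear map
`T : E → C_p([0,1])`. -/
theorem stmt6 :
    ∃ D : Set (ℕ → Bool), D.Countable ∧
      ∃ (E : Submodule ℝ ↥(Cp ↥(Dᶜ)))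
        (T : ↥E →L[ℝ] ↥(Cp ↥unitInterval)),
        Dense (E : Set ↥(Cp ↥(Dᶜ))) ∧ Function.Surjective T := by
  obtain ⟨D, hD, hbij⟩ := exists_countable_compl_bijective_fromBinary
  have hφ : Continuous fun x : ↥Dᶜ ↦ Real.fromBinary x :=
    Real.fromBinary_continuous.comp continuous_subtype_val
  obtain ⟨T, hT⟩ := Cp.exists_leftInverse_comap hφ hbij.surjective
  refine ⟨D, hD, LinearMap.range (Cp.comap _ hφ), T, ?_, fun g ↦ ⟨_, hT g⟩⟩
  exact Cp.denseRange_comap hφ hbij.injective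
end

section
/- Let A and B be directed partially ordered sets in which every countable chain has a supremum. Let S_X = (X_α, p_{αα′} : X_{α′} → X_α for α ≤ α′) and S_Y = (Y_β, q_{ββ′} : Y_{β′} → Y_β for β ≤ β′) be inverse systems of compact metrizable spaces with all bonding maps continuous and surjective, with limits X = lim S_X and Y = lim S_Y and surjective limit projections p_α : X → X_α and q_β : Y → Y_β, such that: (i) for every countable chain in the index set with supremum γ, the canonical map from the γ-th space to the inverse limit of the spaces over the chain is a homeomorphism; and (ii) every continuous function X → ℝ (respectively Y → ℝ) factors as f_α ∘ p_α for some index α and continuous f_α (respectively through some q_β). Let T : C_p(X) → C_p(Y) be a continuous linear map. Then for every α ∈ A and every β₀ ∈ B there exist β ∈ B with β ≥ β₀, a dense linear subspace D of C_p(X_α), and a continuous linear map T_{α,β} : D → C_p(Y_β) such that T(f ∘ p_α) = T_{α,β}(f) ∘ q_β for every f ∈ D. -/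
/-- The limit of an inverse system `(Xa, p)` over a preorder `A`: the subspace of
threads inside the product `∀ a, Xa a` (with the product/subspace topology). -/
abbrev InvLim {A : Type*} [Preorder A] (Xa : A → Type*)
    (p : ∀ ⦃a a'⦄, a ≤ a' → Xa a' → Xa a) : Type _ :=
  {x : ∀ a, Xa a // ∀ (a a' : A) (h : a ≤ a'), p h (x a') = x a}

/-- The canonical map from the `γ`-th space of an inverse system to the limit of the
restriction of the system to a subset `C` of the index set, when `γ` is an upper bound
of `C`. -/
def canonicalChainMap {A : Type*} [Preorder A] (Xa : A → Type*)
    (p : ∀ ⦃a a'⦄, a ≤ a' → Xa a' → Xa a)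
    (hp : ∀ ⦃a a' a''⦄ (h : a ≤ a') (h' : a' ≤ a'') (x : Xa a''),
      p h (p h' x) = p (h.trans h') x)
    (C : Set A) (γ : A) (hγ : γ ∈ upperBounds C) (z : Xa γ) :
    InvLim (fun c : C => Xa c) (fun c c' h => p h) :=
  ⟨fun c => p (hγ c.2) z, fun c c' h => hp h (hγ c'.2) z⟩

/-- An inverse system `(Xa, p)` of topological spaces over a partial order is a
factorizing ω-spectrum with surjective bonding maps and projections if: the bonding maps
are continuous surjections satisfying the usual compatibility conditions; the limit
projections are surjective; for every countable chain `C` with supremum `γ`, the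
canonical map from `Xa γ` to the limit of the system restricted to `C` is a
homeomorphism; and every continuous real-valued function on the limit factors through
some projection. -/
structure IsFactorizingOmegaSpectrum {A : Type*} [PartialOrder A] (Xa : A → Type*)
    [∀ a, TopologicalSpace (Xa a)]
    (p : ∀ ⦃a a'⦄, a ≤ a' → Xa a' → Xa a) : Prop where
  cont_bonding : ∀ ⦃a a'⦄ (h : a ≤ a'), Continuous (p h)
  surj_bonding : ∀ ⦃a a'⦄ (h : a ≤ a'), Function.Surjective (p h)
  bonding_refl : ∀ (a : A) (x : Xa a), p (le_refl a) x = x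
  bonding_comp : ∀ ⦃a a' a''⦄ (h : a ≤ a') (h' : a' ≤ a'') (x : Xa a''),
    p h (p h' x) = p (h.trans h') x
  surj_proj : ∀ a : A, Function.Surjective (fun x : InvLim Xa p => x.1 a)
  omega_continuous : ∀ (C : Set A) (γ : A), C.Countable → IsChain (· ≤ ·) C →
    C.Nonempty → (hγ : IsLUB C γ) →
    IsHomeomorph (canonicalChainMap Xa p bonding_comp C γ hγ.1)
  factorizing : ∀ f : InvLim Xa p → ℝ, Continuous f →
    ∃ (a : A) (g : Xa a → ℝ), Continuous g ∧ f = fun x => g (x.1 a)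


/-- Composition with a continuous map, as a continuous linear map between spaces of continuous
functions with the topology of pointwise convergence. -/
def Cp.compRight {X Y : Type*} [TopologicalSpace X] [TopologicalSpace Y] (φ : X → Y)
    (hφ : Continuous φ) : ↥(Cp Y) →L[ℝ] ↥(Cp X) where
  toFun f := ⟨fun x => (f : Y → ℝ) (φ x), f.2.comp hφ⟩
  map_add' _ _ := rfl
  map_smul' _ _ := rfl
  cont := Continuous.subtype_mk (f := fun (f : ↥(Cp Y)) x => (f : Y → ℝ) (φ x))
    (continuous_pi fun x => (continuous_apply (φ x)).comp continuous_subtype_val)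
    fun f => f.2.comp hφ

/-- The space `Cp X` over a compact metrizable space is separable. -/
theorem Cp.exists_denseRange_nat (X : Type*) [TopologicalSpace X] [CompactSpace X]
    [TopologicalSpace.MetrizableSpace X] : ∃ u : ℕ → ↥(Cp X), DenseRange u := by
  let := TopologicalSpace.metrizableSpaceMetric X
  let e : C(X, ℝ) → ↥(Cp X) := fun f => ⟨f, f.continuous⟩
  have he : Continuous e :=
    (continuous_pi fun x => continuous_eval_const x).subtype_mk _
  have hsurj : Function.Surjective e := fun f => ⟨⟨f, f.2⟩, rfl⟩
  exact ⟨e ∘ TopologicalSpace.denseSeq C(X, ℝ),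
    hsurj.denseRange.comp (TopologicalSpace.denseRange_denseSeq _) he⟩

/-- In a directed preorder whose nonempty countable chains have suprema, every sequence has an
upper bound above a given element. -/
theorem exists_ge_forall_ge_of_countable_chains {B : Type*} [Preorder B]
    [IsDirected B (· ≤ ·)]
    (hsup : ∀ C : Set B, C.Countable → IsChain (· ≤ ·) C → C.Nonempty → ∃ γ, IsLUB C γ)
    (b₀ : B) (b : ℕ → B) : ∃ γ, b₀ ≤ γ ∧ ∀ n, b n ≤ γ := by
  choose m hm₁ hm₂ using fun x y : B => exists_ge_ge x y
  let c : ℕ → B := fun n => Nat.rec b₀ (fun k x => m x (b k)) n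
  have hc : Monotone c := monotone_nat_of_le_succ fun n => hm₁ (c n) (b n)
  obtain ⟨γ, hγ⟩ := hsup (Set.range c) (Set.countable_range c) hc.isChain_range
    (Set.range_nonempty c)
  exact ⟨γ, hγ.1 ⟨0, rfl⟩, fun n => (hm₂ (c n) (b n)).trans (hγ.1 ⟨n + 1, rfl⟩)⟩

/-- If every element of `E` is sent by a continuous linear map `S` to a function factoring through
the surjection `φ`, then `S` factors on `E` through a continuous linear map into `Cp Z`. -/
theorem Cp.exists_continuousLinearMap_factor {E Y Z : Type*} [AddCommMonoid E] [Module ℝ E]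
    [TopologicalSpace E] [TopologicalSpace Y] [TopologicalSpace Z] (φ : Y → Z)
    (hφ : Continuous φ) (hsurj : Function.Surjective φ) (S : E →L[ℝ] ↥(Cp Y))
    (hS : ∀ f, ∃ g, Cp.compRight φ hφ g = S f) :
    ∃ R : E →L[ℝ] ↥(Cp Z), ∀ f, S f = Cp.compRight φ hφ (R f) := by
  obtain ⟨s, hs⟩ := hsurj.hasRightInverse
  have key : ∀ f g, Cp.compRight φ hφ g = S f →
      (fun z => (S f : Y → ℝ) (s z)) = (g : Z → ℝ) := by
    intro f g h
    funext z
    rw [← h]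
    exact congrArg (g : Z → ℝ) (hs z)
  have hcont : ∀ f, (fun z => (S f : Y → ℝ) (s z)) ∈ Cp Z := by
    intro f
    obtain ⟨g, hg⟩ := hS f
    rw [key f g hg]
    exact g.2
  refine ⟨{ toFun := fun f => ⟨fun z => (S f : Y → ℝ) (s z), hcont f⟩
            map_add' := fun f g => ?_
            map_smul' := fun r f => ?_
            cont := ?_ }, fun f => ?_⟩
  · ext z
    simp
  · ext z
    simp
  · exact (continuous_pi fun z =>
      (continuous_apply (s z)).comp (continuous_subtype_val.comp S.continuous)).subtype_mk _
  · obtain ⟨g, hg⟩ := hS f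
    rw [← hg]
    exact congrArg _ (Subtype.ext (key f g hg).symm)


/-- Let `S_X`, `S_Y` be factorizing ω-spectra of compact metrizable spaces, with
surjective bonding maps and projections, over directed partial orders `A`, `B` in which
every countable chain has a supremum, with limits `X`, `Y`. Let `T : C_p(X) → C_p(Y)` be
a continuous linear map. Then for every `α ∈ A` and `β₀ ∈ B` there are `β ≥ β₀`, a dense
linear subspace `D` of `C_p(X_α)`, and a continuous linear map
`T_{α,β} : D → C_p(Y_β)` with `T(f ∘ p_α) = T_{α,β}(f) ∘ q_β` for all `f ∈ D`. -/
theorem stmt8 {A B : Type} [PartialOrder A] [PartialOrder B]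
    [IsDirected A (· ≤ ·)] [IsDirected B (· ≤ ·)]
    (hsupA : ∀ C : Set A, C.Countable → IsChain (· ≤ ·) C → C.Nonempty →
      ∃ γ, IsLUB C γ)
    (hsupB : ∀ C : Set B, C.Countable → IsChain (· ≤ ·) C → C.Nonempty →
      ∃ γ, IsLUB C γ)
    (Xa : A → Type) [∀ a, TopologicalSpace (Xa a)] [∀ a, CompactSpace (Xa a)]
    [∀ a, TopologicalSpace.MetrizableSpace (Xa a)]
    (p : ∀ ⦃a a'⦄, a ≤ a' → Xa a' → Xa a)
    (Yb : B → Type) [∀ b, TopologicalSpace (Yb b)] [∀ b, CompactSpace (Yb b)]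
    [∀ b, TopologicalSpace.MetrizableSpace (Yb b)]
    (q : ∀ ⦃b b'⦄, b ≤ b' → Yb b' → Yb b)
    (hSX : IsFactorizingOmegaSpectrum Xa p)
    (hSY : IsFactorizingOmegaSpectrum Yb q)
    (T : ↥(Cp (InvLim Xa p)) →L[ℝ] ↥(Cp (InvLim Yb q)))
    (α : A) (β₀ : B) :
    ∃ β : B, β₀ ≤ β ∧
      ∃ D : Submodule ℝ ↥(Cp (Xa α)), Dense (D : Set ↥(Cp (Xa α))) ∧
        ∃ Tab : ↥D →L[ℝ] ↥(Cp (Yb β)),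
          ∀ f : ↥D,
            T ⟨fun x : InvLim Xa p => ((f : ↥(Cp (Xa α))) : Xa α → ℝ) (x.1 α),
                (f : ↥(Cp (Xa α))).2.comp
                  ((continuous_apply α).comp continuous_subtype_val)⟩ =
              ⟨fun y : InvLim Yb q => ((Tab f : ↥(Cp (Yb β))) : Yb β → ℝ) (y.1 β),
                (Tab f).2.comp
                  ((continuous_apply β).comp continuous_subtype_val)⟩ := by
  have hproj : Continuous fun x : InvLim Xa p => x.1 α :=
    (continuous_apply α).comp continuous_subtype_val
  have hprojY : ∀ b, Continuous fun y : InvLim Yb q => y.1 b :=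
    fun b => (continuous_apply b).comp continuous_subtype_val
  let L := T.comp (Cp.compRight _ hproj)
  obtain ⟨u, hu⟩ := Cp.exists_denseRange_nat (Xa α)
  choose b g hg hfac using fun n => hSY.factorizing (L (u n)) (L (u n)).2
  obtain ⟨β, hβ₀, hβ⟩ := exists_ge_forall_ge_of_countable_chains hsupB β₀ b
  let D : Submodule ℝ ↥(Cp (Xa α)) :=
    (LinearMap.range (Cp.compRight _ (hprojY β)).toLinearMap).comap L.toLinearMap
  have huD : Set.range u ⊆ (D : Set ↥(Cp (Xa α))) := by
    rintro _ ⟨n, rfl⟩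
    refine ⟨⟨fun z => g n (q (hβ n) z), (hg n).comp (hSY.cont_bonding _)⟩, Subtype.ext ?_⟩
    refine Eq.trans ?_ (hfac n).symm
    funext y
    exact congrArg (g n) (y.2 _ _ (hβ n))
  obtain ⟨R, hR⟩ := Cp.exists_continuousLinearMap_factor _ (hprojY β) (hSY.surj_proj β)
    (L.comp D.subtypeL) fun f => f.2
  exact ⟨β, hβ₀, D, hu.mono huD, R, hR⟩
end

section
/- Let A and B be directed partially ordered sets in which every countable chain has a supremum. Let S_X = (X_α, p_{αα′}) and S_Y = (Y_β, q_{ββ′}) be inverse systems of compact metrizable spaces with all bonding maps continuous and surjective, with limits X = lim S_X and Y = lim S_Y and surjective limit projections p_α : X → X_α and q_β : Y → Y_β, such that: (i) for every countable chain in the index set with supremum γ, the canonical map from the γ-th space to the inverse limit of the spaces over the chain is a homeomorphism; and (ii) every continuous function X → ℝ (respectively Y → ℝ) factors through some limit projection. Let T : C_p(X) → C_p(Y) be a surjective continuous linear map. Then for every α₀ ∈ A and every β₀ ∈ B there exist α ∈ A with α ≥ α₀, β ∈ B with β ≥ β₀, a dense linear subspace D of C_p(X_α), and a continuous linear map T_{α,β}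 : D → C_p(Y_β) whose image is dense in C_p(Y_β), such that T(f ∘ p_α) = T_{α,β}(f) ∘ q_β for every f ∈ D. -/
/-- The continuous linear map `g ↦ g ∘ φ` from `Cp Y` to `Cp X`. -/
def cpPullback {X Y : Type*} [TopologicalSpace X] [TopologicalSpace Y] (φ : C(X, Y)) :
    ↥(Cp Y) →L[ℝ] ↥(Cp X) where
  toFun g := ⟨fun x => (g : Y → ℝ) (φ x), g.2.comp φ.continuous⟩
  map_add' _ _ := rfl
  map_smul' _ _ := rfl
  cont := continuous_induced_rng.2
    (continuous_pi fun x => (continuous_apply (φ x)).comp continuous_subtype_val)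

lemma cpPullback_injective {X Y : Type*} [TopologicalSpace X] [TopologicalSpace Y] {φ : C(X, Y)}
    (hφ : Function.Surjective φ) : Function.Injective (cpPullback φ) := by
  intro f g h
  ext y
  obtain ⟨x, rfl⟩ := hφ y
  exact congrFun (congrArg Subtype.val h) x

lemma continuous_of_cpPullback_comp {X Y Z : Type*} [TopologicalSpace X] [TopologicalSpace Y]
    [TopologicalSpace Z] {φ : C(X, Y)} (hφ : Function.Surjective φ) {f : Z → ↥(Cp Y)}
    (hf : Continuous fun z => cpPullback φ (f z)) : Continuous f := by
  refine continuous_induced_rng.2 (continuous_pi fun y => ?_)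
  obtain ⟨x, rfl⟩ := hφ y
  exact (continuous_apply x).comp (continuous_subtype_val.comp hf)

/-- A continuous function, regarded as an element of `Cp X`. -/
def toCp {X : Type*} [TopologicalSpace X] (f : C(X, ℝ)) : ↥(Cp X) := ⟨f, f.continuous⟩

lemma continuous_toCp {X : Type*} [TopologicalSpace X] :
    Continuous (toCp : C(X, ℝ) → ↥(Cp X)) :=
  Continuous.subtype_mk (continuous_pi fun x => continuous_eval_const x) _

lemma toCp_surjective {X : Type*} [TopologicalSpace X] :
    Function.Surjective (toCp : C(X, ℝ) → ↥(Cp X)) :=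
  fun f => ⟨⟨f, f.2⟩, rfl⟩

lemma exists_upperBound_of_countable {A : Type*} [PartialOrder A] [IsDirected A (· ≤ ·)]
    (hsup : ∀ C : Set A, C.Countable → IsChain (· ≤ ·) C → C.Nonempty → ∃ γ, IsLUB C γ)
    {S : Set A} (hS : S.Countable) (a₀ : A) : ∃ a, a₀ ≤ a ∧ ∀ s ∈ S, s ≤ a := by
  obtain ⟨e, he⟩ := (hS.insert a₀).exists_eq_range (Set.insert_nonempty _ _)
  choose j hj₁ hj₂ using fun a b : A => directed_of (· ≤ ·) a b
  let u : ℕ → A := fun n => Nat.rec (e 0) (fun n x => j x (e n)) n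
  have hu : Monotone u := monotone_nat_of_le_succ fun n => hj₁ _ _
  obtain ⟨γ, hγ⟩ := hsup (Set.range u) (Set.countable_range u) hu.isChain_range
    (Set.range_nonempty u)
  have hle : ∀ s ∈ insert a₀ S, s ≤ γ := by
    rw [he]
    rintro _ ⟨n, rfl⟩
    exact (hj₂ (u n) (e n)).trans (hγ.1 ⟨n + 1, rfl⟩)
  exact ⟨γ, hle a₀ (Set.mem_insert _ _), fun s hs => hle s (Set.mem_insert_of_mem _ hs)⟩

namespace IsFactorizingOmegaSpectrum

variable {A : Type*} [PartialOrder A] {Xa : A → Type*} [∀ a, TopologicalSpace (Xa a)]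
  {p : ∀ ⦃a a'⦄, a ≤ a' → Xa a' → Xa a}

/-- The bonding maps as bundled continuous maps. -/
def bond (hS : IsFactorizingOmegaSpectrum Xa p) {a a' : A} (h : a ≤ a') : C(Xa a', Xa a) :=
  ⟨p h, hS.cont_bonding h⟩

/-- The limit projections as bundled continuous maps. -/
def proj (_ : IsFactorizingOmegaSpectrum Xa p) (a : A) : C(InvLim Xa p, Xa a) :=
  ⟨fun x => x.1 a, (continuous_apply a).comp continuous_subtype_val⟩

lemma cpPullback_proj_bond (hS : IsFactorizingOmegaSpectrum Xa p) {a a' : A} (h : a ≤ a')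
    (g : ↥(Cp (Xa a))) :
    cpPullback (hS.proj a') (cpPullback (hS.bond h) g) = cpPullback (hS.proj a) g := by
  ext x
  exact congrArg (g : Xa a → ℝ) (x.2 a a' h)

lemma exists_cpPullback_proj_eq (hS : IsFactorizingOmegaSpectrum Xa p)
    (f : ↥(Cp (InvLim Xa p))) : ∃ (a : A) (g : ↥(Cp (Xa a))), cpPullback (hS.proj a) g = f := by
  obtain ⟨a, g, hg, hfg⟩ := hS.factorizing f f.2
  exact ⟨a, ⟨g, hg⟩, Subtype.ext hfg.symm⟩

/-- Countably many functions on the limit factor through a common projection. -/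
lemma exists_ge_forall_mem_range (hS : IsFactorizingOmegaSpectrum Xa p)
    [IsDirected A (· ≤ ·)]
    (hsup : ∀ C : Set A, C.Countable → IsChain (· ≤ ·) C → C.Nonempty → ∃ γ, IsLUB C γ)
    {E : Set ↥(Cp (InvLim Xa p))} (hE : E.Countable) (a₀ : A) :
    ∃ a, a₀ ≤ a ∧ ∀ f ∈ E, ∃ g, cpPullback (hS.proj a) g = f := by
  choose i g hg using hS.exists_cpPullback_proj_eq
  obtain ⟨a, ha₀, ha⟩ := exists_upperBound_of_countable hsup (hE.image i) a₀
  refine ⟨a, ha₀, fun f hf => ⟨cpPullback (hS.bond (ha _ ⟨f, hf, rfl⟩)) (g f), ?_⟩⟩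
  rw [hS.cpPullback_proj_bond, hg]

/-- If `γ` is the supremum of a sequence of indices, then the functions on `Xa γ` induced from
dense sets of functions on the spaces of the sequence are dense. -/
lemma dense_cpPullback_bond (hS : IsFactorizingOmegaSpectrum Xa p) [∀ a, CompactSpace (Xa a)]
    [∀ a, T2Space (Xa a)] {u : ℕ → A} (hu : Monotone u) {γ : A}
    (hγ : IsLUB (Set.range u) γ) {E : ∀ a, Set C(Xa a, ℝ)} (hE : ∀ a, Dense (E a)) :
    Dense {h : ↥(Cp (Xa γ)) |
      ∃ n, ∃ g ∈ E (u n), h = cpPullback (hS.bond (hγ.1 ⟨n, rfl⟩)) (toCp g)} := by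
  have hle : ∀ n, u n ≤ γ := fun n => hγ.1 ⟨n, rfl⟩
  let K : ℕ → Subalgebra ℝ C(Xa γ, ℝ) := fun n =>
    (ContinuousMap.compRightAlgHom ℝ ℝ (hS.bond (hle n))).range
  have hK : Monotone K := by
    rintro m n hmn _ ⟨g, rfl⟩
    refine ⟨g.comp (hS.bond (hu hmn)), ?_⟩
    ext x
    exact congrArg g (hS.bonding_comp (hu hmn) (hle n) x)
  have hsep : (iSup K).SeparatesPoints := by
    intro x y hxy
    obtain ⟨n, hn⟩ : ∃ n, p (hle n) x ≠ p (hle n) y := by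
      by_contra! hc
      refine hxy ((hS.omega_continuous _ γ (Set.countable_range u) hu.isChain_range
        (Set.range_nonempty u) hγ).injective (Subtype.ext (funext ?_)))
      rintro ⟨_, n, rfl⟩
      exact hc n
    obtain ⟨g, hg⟩ : ∃ g : C(Xa (u n), ℝ), g (p (hle n) x) ≠ g (p (hle n) y) := by
      obtain ⟨g, h₀, h₁, -⟩ := exists_continuous_zero_one_of_isClosed
        (isClosed_singleton (x := p (hle n) x)) (isClosed_singleton (x := p (hle n) y))
        (Set.disjoint_singleton.2 hn)
      refine ⟨g, ?_⟩
      rw [h₀ rfl, h₁ rfl]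
      simp
    exact ⟨_, ⟨g.comp (hS.bond (hle n)), le_iSup K n ⟨g, rfl⟩, rfl⟩, hg⟩
  have hdense : Dense {h : C(Xa γ, ℝ) | ∃ n, ∃ g ∈ E (u n), h = g.comp (hS.bond (hle n))} := by
    rw [← dense_closure]
    refine Dense.mono ?_ (fun f =>
      ContinuousMap.continuousMap_mem_subalgebra_closure_of_separatesPoints (iSup K) hsep f)
    refine (Subalgebra.coe_iSup_of_directed hK.directed_le).trans_subset
      (Set.iUnion_subset fun n => ?_)
    rintro _ ⟨g, rfl⟩
    refine closure_mono ?_ (image_closure_subset_closure_image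
      (ContinuousMap.continuous_precomp (hS.bond (hle n))) ⟨g, hE (u n) g, rfl⟩)
    rintro _ ⟨g, hg, rfl⟩
    exact ⟨n, g, hg, rfl⟩
  refine (toCp_surjective.denseRange.dense_image continuous_toCp hdense).mono ?_
  rintro _ ⟨_, ⟨n, g, hg, rfl⟩, rfl⟩
  exact ⟨n, g, hg, rfl⟩

end IsFactorizingOmegaSpectrum

/-- Let `S_X`, `S_Y` be factorizing ω-spectra of compact metrizable spaces, with
surjective bonding maps and projections, over directed partial orders `A`, `B` in which
every countable chain has a supremum, with limits `X`, `Y`. Let `T : C_p(X) → C_p(Y)` be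
a surjective continuous linear map. Then for every `α₀ ∈ A` and `β₀ ∈ B` there are
`α ≥ α₀`, `β ≥ β₀`, a dense linear subspace `D` of `C_p(X_α)`, and a continuous linear
map `T_{α,β} : D → C_p(Y_β)` with dense image such that `T(f ∘ p_α) = T_{α,β}(f) ∘ q_β`
for all `f ∈ D`. -/
theorem stmt9 {A B : Type} [PartialOrder A] [PartialOrder B]
    [IsDirected A (· ≤ ·)] [IsDirected B (· ≤ ·)]
    (hsupA : ∀ C : Set A, C.Countable → IsChain (· ≤ ·) C → C.Nonempty →
      ∃ γ, IsLUB C γ)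
    (hsupB : ∀ C : Set B, C.Countable → IsChain (· ≤ ·) C → C.Nonempty →
      ∃ γ, IsLUB C γ)
    (Xa : A → Type) [∀ a, TopologicalSpace (Xa a)] [∀ a, CompactSpace (Xa a)]
    [∀ a, TopologicalSpace.MetrizableSpace (Xa a)]
    (p : ∀ ⦃a a'⦄, a ≤ a' → Xa a' → Xa a)
    (Yb : B → Type) [∀ b, TopologicalSpace (Yb b)] [∀ b, CompactSpace (Yb b)]
    [∀ b, TopologicalSpace.MetrizableSpace (Yb b)]
    (q : ∀ ⦃b b'⦄, b ≤ b' → Yb b' → Yb b)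
    (hSX : IsFactorizingOmegaSpectrum Xa p)
    (hSY : IsFactorizingOmegaSpectrum Yb q)
    (T : ↥(Cp (InvLim Xa p)) →L[ℝ] ↥(Cp (InvLim Yb q)))
    (hT : Function.Surjective T)
    (α₀ : A) (β₀ : B) :
    ∃ α : A, α₀ ≤ α ∧ ∃ β : B, β₀ ≤ β ∧
      ∃ D : Submodule ℝ ↥(Cp (Xa α)), Dense (D : Set ↥(Cp (Xa α))) ∧
        ∃ Tab : ↥D →L[ℝ] ↥(Cp (Yb β)), DenseRange Tab ∧
          ∀ f : ↥D,
            T ⟨fun x : InvLim Xa p => ((f : ↥(Cp (Xa α))) : Xa α → ℝ) (x.1 α),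
                (f : ↥(Cp (Xa α))).2.comp
                  ((continuous_apply α).comp continuous_subtype_val)⟩ =
              ⟨fun y : InvLim Yb q => ((Tab f : ↥(Cp (Yb β))) : Yb β → ℝ) (y.1 β),
                (Tab f).2.comp
                  ((continuous_apply β).comp continuous_subtype_val)⟩ := by
  choose E hEc hEd using fun a => TopologicalSpace.exists_countable_dense C(Xa a, ℝ)
  choose F hFc hFd using fun b => TopologicalSpace.exists_countable_dense C(Yb b, ℝ)
  choose R hR using hT
  choose sB hsB hsBE using fun (a : A) (b : B) => hSY.exists_ge_forall_mem_range hsupB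
    ((hEc a).image fun g => T (cpPullback (hSX.proj a) (toCp g))) b
  choose sA hsA hsAF using fun (a : A) (b : B) => hSX.exists_ge_forall_mem_range hsupA
    ((hFc b).image fun g => R (cpPullback (hSY.proj b) (toCp g))) a
  let w : ℕ → A × B := fun n => Nat.rec (α₀, β₀) (fun _ x => (sA x.1 x.2, sB x.1 x.2)) n
  let u : ℕ → A := fun n => (w n).1
  let v : ℕ → B := fun n => (w n).2
  have hu : Monotone u := monotone_nat_of_le_succ fun n => hsA _ _
  have hv : Monotone v := monotone_nat_of_le_succ fun n => hsB _ _
  obtain ⟨α, hα⟩ := hsupA _ (Set.countable_range u) hu.isChain_range (Set.range_nonempty u)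
  obtain ⟨β, hβ⟩ := hsupB _ (Set.countable_range v) hv.isChain_range (Set.range_nonempty v)
  have hinj := cpPullback_injective (φ := hSY.proj β) (hSY.surj_proj β)
  let e := LinearEquiv.ofInjective (cpPullback (hSY.proj β)).toLinearMap hinj
  let S : ↥(Cp (Xa α)) →L[ℝ] ↥(Cp (InvLim Yb q)) := T.comp (cpPullback (hSX.proj α))
  let D : Submodule ℝ ↥(Cp (Xa α)) :=
    (cpPullback (hSY.proj β)).toLinearMap.range.comap S.toLinearMap
  let L : ↥D →ₗ[ℝ] ↥(Cp (Yb β)) :=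
    e.symm.toLinearMap ∘ₗ S.toLinearMap.restrict (p := D) fun _ h => h
  have hL : ∀ f : ↥D, cpPullback (hSY.proj β) (L f) = S f := fun f =>
    congrArg Subtype.val (e.apply_symm_apply _)
  have hLc : Continuous L := by
    refine continuous_of_cpPullback_comp (φ := hSY.proj β) (hSY.surj_proj β) ?_
    simp only [hL]
    exact S.continuous.comp continuous_subtype_val
  refine ⟨α, hα.1 ⟨0, rfl⟩, β, hβ.1 ⟨0, rfl⟩, D, ?_, ⟨L, hLc⟩, ?_, fun f => (hL f).symm⟩
  · refine (hSX.dense_cpPullback_bond hu hα hEd).mono ?_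
    rintro _ ⟨n, g, hg, rfl⟩
    obtain ⟨k, hk⟩ := hsBE (u n) (v n) _ ⟨g, hg, rfl⟩
    refine ⟨cpPullback (hSY.bond (hβ.1 ⟨n + 1, rfl⟩)) k, ?_⟩
    change cpPullback _ _ = T (cpPullback _ _)
    rw [hSY.cpPullback_proj_bond, hSX.cpPullback_proj_bond]
    exact hk
  · refine (hSY.dense_cpPullback_bond hv hβ hFd).mono ?_
    rintro _ ⟨n, g, hg, rfl⟩
    obtain ⟨k, hk⟩ := hsAF (u n) (v n) _ ⟨g, hg, rfl⟩
    have hS : S (cpPullback (hSX.bond (hα.1 ⟨n + 1, rfl⟩)) k) =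
        cpPullback (hSY.proj (v n)) (toCp g) := by
      change T (cpPullback _ _) = _
      rw [hSX.cpPullback_proj_bond]
      exact (congrArg T hk).trans (hR _)
    rw [← hSY.cpPullback_proj_bond (hβ.1 ⟨n, rfl⟩)] at hS
    exact ⟨⟨_, _, hS.symm⟩, hinj ((hL _).trans hS)⟩
end

section
/- Let X be a compact metrizable space and let S be the convergent sequence, i.e., the one-point compactification of the natural numbers with the discrete topology (homeomorphic to the subspace {0} ∪ {1/n : n ∈ ℕ, n ≥ 1} of ℝ). Then there exists a continuous surjection H : C_p(S) → C_p(X) (not required to be linear). -/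
open Filter Topology

/-- Radial retraction of a normed space onto the closed ball of radius `R`. -/
noncomputable def radialClip {E : Type*} [NormedAddCommGroup E] [NormedSpace ℝ E] (R : ℝ)
    (y : E) : E :=
  (R / max R ‖y‖) • y

section radialClip

variable {E : Type*} [NormedAddCommGroup E] [NormedSpace ℝ E] {R : ℝ}

theorem continuous_radialClip (hR : 0 < R) : Continuous (radialClip (E := E) R) := by
  unfold radialClip
  refine Continuous.smul (Continuous.div continuous_const (by fun_prop) fun y => ?_) continuous_id
  exact (lt_max_of_lt_left hR).ne'

theorem norm_radialClip_le (hR : 0 < R) (y : E) : ‖radialClip R y‖ ≤ R := by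
  have h : 0 < max R ‖y‖ := lt_max_of_lt_left hR
  rw [radialClip, norm_smul, Real.norm_of_nonneg (by positivity), div_mul_eq_mul_div,
    div_le_iff₀ h]
  exact mul_le_mul_of_nonneg_left (le_max_right _ _) hR.le

theorem radialClip_of_norm_le (hR : 0 < R) {y : E} (hy : ‖y‖ ≤ R) : radialClip R y = y := by
  rw [radialClip, max_eq_left hy, div_self hR.ne', one_smul]

end radialClip

/-- If continuous maps `g n` into a Banach space can be made to take any prescribed sequence of values
in a dense sequence at a common point, then there is a continuous surjection onto that space. -/
theorem exists_continuous_surjective_of_selectors {Z E : Type*} [TopologicalSpace Z]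
    [NormedAddCommGroup E] [NormedSpace ℝ E] [CompleteSpace E] {d : ℕ → E} (hd : DenseRange d)
    {g : ℕ → Z → E} (hg : ∀ n, Continuous (g n))
    (hgd : ∀ k : ℕ → ℕ, ∃ z, ∀ n, g n z = d (k n)) :
    ∃ G : Z → E, Continuous G ∧ Function.Surjective G := by
  let R : ℕ → ℝ := fun n => 2 * (1 / 2) ^ n
  have hR : ∀ n, 0 < R n := fun n => by positivity
  have hRsum : Summable R := summable_geometric_two.mul_left 2
  let u : ℕ → Z → E := fun n =>
    Nat.rec (g 0) (fun n v z => v z + radialClip (R n) (g (n + 1) z - v z)) n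
  have u_succ : ∀ n z, u (n + 1) z = u n z + radialClip (R n) (g (n + 1) z - u n z) :=
    fun _ _ => rfl
  have hu : ∀ n, Continuous (u n) := by
    intro n
    induction n with
    | zero => exact hg 0
    | succ n ih => exact ih.add ((continuous_radialClip (hR n)).comp ((hg (n + 1)).sub ih))
  have hbound : ∀ n z, ‖radialClip (R n) (g (n + 1) z - u n z)‖ ≤ R n :=
    fun n z => norm_radialClip_le (hR n) _
  have hlim : ∀ z, Tendsto (fun n => u n z) atTop
      (𝓝 (g 0 z + ∑' n, radialClip (R n) (g (n + 1) z - u n z))) := by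
    intro z
    have h := (Summable.of_norm_bounded hRsum fun n => hbound n z).hasSum.tendsto_sum_nat.const_add
      (g 0 z)
    refine h.congr fun n => ?_
    induction n with
    | zero => simp [u]
    | succ n ih => rw [Finset.sum_range_succ, ← add_assoc, ih, u_succ]
  refine ⟨fun z => g 0 z + ∑' n, radialClip (R n) (g (n + 1) z - u n z),
    (hg 0).add (continuous_tsum
      (fun n => (continuous_radialClip (hR n)).comp ((hg (n + 1)).sub (hu n))) hRsum hbound), ?_⟩
  intro y
  choose k hk using fun n : ℕ => hd.exists_dist_lt y (ε := (1 / 2) ^ n) (by positivity)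
  obtain ⟨z, hz⟩ := hgd k
  have huz : ∀ n, u n z = d (k n) := by
    intro n
    induction n with
    | zero => exact hz 0
    | succ n ih =>
      have hle : ‖d (k (n + 1)) - d (k n)‖ ≤ R n := by
        rw [← dist_eq_norm]
        have h₁ := dist_triangle_left (d (k (n + 1))) (d (k n)) y
        have h₂ := hk (n + 1)
        have h₃ := hk n
        have h₄ : (0 : ℝ) < (1 / 2) ^ n := by positivity
        simp only [R]
        rw [pow_succ] at h₂
        linarith
      rw [u_succ, ih, hz, radialClip_of_norm_le (hR n) hle, add_sub_cancel]
  refine ⟨z, tendsto_nhds_unique (hlim z) ?_⟩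
  simp only [huz]
  rw [tendsto_iff_dist_tendsto_zero]
  refine squeeze_zero (fun _ => dist_nonneg) (fun n => ?_)
    (tendsto_pow_atTop_nhds_zero_of_lt_one (r := (1 / 2 : ℝ)) (by norm_num) (by norm_num))
  rw [dist_comm]
  exact (hk n).le

/-- The path-like map `d 0 + ∑ₘ (∏_{i ≤ m} a i) • (d (m + 1) - d m)`. -/
noncomputable def weightedPath {Z E : Type*} [NormedAddCommGroup E] [NormedSpace ℝ E]
    (a : ℕ → Z → ℝ) (d : ℕ → E) (z : Z) : E :=
  d 0 + ∑ᶠ m, (∏ i ∈ Finset.range (m + 1), a i z) • (d (m + 1) - d m)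

section weightedPath

variable {Z E : Type*} [NormedAddCommGroup E] [NormedSpace ℝ E] {a : ℕ → Z → ℝ}

theorem continuous_weightedPath [TopologicalSpace Z] (ha : ∀ m, Continuous (a m))
    (ha₀ : ∀ z, ∃ m, ∀ᶠ z' in 𝓝 z, a m z' = 0) (d : ℕ → E) :
    Continuous (weightedPath a d) := by
  refine continuous_const.add (continuous_finsum (fun m => ?_) fun z => ?_)
  · exact (continuous_finsetProd _ fun i _ => ha i).smul continuous_const
  · obtain ⟨m, hm⟩ := ha₀ z
    refine ⟨_, hm, (Set.finite_lt_nat m).subset ?_⟩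
    rintro j ⟨z', hj, hz'⟩
    by_contra hjm
    refine hj ?_
    have : ∏ i ∈ Finset.range (j + 1), a i z' = 0 :=
      Finset.prod_eq_zero (i := m) (by simp at hjm ⊢; omega) hz'
    simp [this]

theorem weightedPath_eq {z : Z} {k : ℕ} (hz : ∀ m, a m z = if m < k then 1 else 0)
    (d : ℕ → E) : weightedPath a d z = d k := by
  have hprod : ∀ m, ∏ i ∈ Finset.range (m + 1), a i z = if m < k then 1 else 0 := by
    intro m
    split_ifs with hm
    · refine Finset.prod_eq_one fun i hi => ?_
      rw [hz, if_pos (by simp at hi; omega)]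
    · exact Finset.prod_eq_zero (i := m) (by simp) (by rw [hz, if_neg hm])
  rw [weightedPath, finsum_eq_sum_of_support_subset (s := Finset.range k)]
  · rw [Finset.sum_congr rfl fun m hm => by
      rw [hprod, if_pos (Finset.mem_range.1 hm), one_smul], Finset.sum_range_sub, add_sub_cancel]
  · intro m hm
    by_contra hmk
    refine hm ?_
    simp only [Finset.coe_range, Set.mem_Iio] at hmk
    simp [hprod, hmk]

end weightedPath

theorem Cp.continuous_eval {X : Type*} [TopologicalSpace X] (x : X) :
    Continuous fun f : Cp X => f.1 x :=
  (continuous_apply x).comp continuous_subtype_val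

/-- The truncated entry at position `(n, m)` of a convergent sequence indexed by `ℕ × ℕ`. -/
noncomputable def Cp.entry (n m : ℕ) (f : Cp (OnePoint ℕ)) : ℝ :=
  max 0 (min 1 (2 * ((n + 1) * (f.1 (Nat.pair n m : ℕ) - f.1 OnePoint.infty)) - 1))

theorem Cp.continuous_entry (n m : ℕ) : Continuous (Cp.entry n m) :=
  continuous_const.max (continuous_const.min ((continuous_const.mul (continuous_const.mul
    ((Cp.continuous_eval _).sub (Cp.continuous_eval _)))).sub continuous_const))

theorem Cp.exists_eventually_entry_eq_zero (n : ℕ) (f : Cp (OnePoint ℕ)) :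
    ∃ m, ∀ᶠ f' in 𝓝 f, Cp.entry n m f' = 0 := by
  have hf : Tendsto (fun i : ℕ => f.1 i) atTop (𝓝 (f.1 OnePoint.infty)) :=
    OnePoint.continuous_iff_from_nat _ |>.1 f.2
  have hpair : Tendsto (Nat.pair n) atTop atTop :=
    tendsto_atTop_mono (Nat.right_le_pair n) tendsto_id
  have hlim : Tendsto (fun m => ((n : ℝ) + 1) * (f.1 (Nat.pair n m : ℕ) - f.1 OnePoint.infty))
      atTop (𝓝 0) := by
    simpa using ((hf.comp hpair).sub_const (f.1 OnePoint.infty)).const_mul ((n : ℝ) + 1)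
  obtain ⟨m, hm⟩ := (hlim.eventually_lt_const (show (0 : ℝ) < 1 / 2 by norm_num)).exists
  refine ⟨m, ?_⟩
  have hcont : Continuous fun f' : Cp (OnePoint ℕ) =>
      ((n : ℝ) + 1) * (f'.1 (Nat.pair n m : ℕ) - f'.1 OnePoint.infty) :=
    continuous_const.mul ((Cp.continuous_eval _).sub (Cp.continuous_eval _))
  filter_upwards [hcont.continuousAt.eventually_lt_const hm] with f' hf'
  exact max_eq_left ((min_le_right _ _).trans (by linarith))

theorem Cp.exists_entry_eq (k : ℕ → ℕ) :
    ∃ f, ∀ n m, Cp.entry n m f = if m < k n then 1 else 0 := by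
  let s : ℕ → ℝ := fun i => if i.unpair.2 < k i.unpair.1 then 1 / ((i.unpair.1 : ℝ) + 1) else 0
  have hs : Tendsto s atTop (𝓝 0) := by
    rw [← Nat.cofinite_eq_atTop, Metric.tendsto_nhds]
    intro ε hε
    obtain ⟨N, hN⟩ := exists_nat_one_div_lt hε
    refine Set.Finite.subset ((Set.finite_lt_nat N).biUnion fun n _ =>
      (Set.finite_lt_nat (k n)).image (Nat.pair n)) fun i hi => ?_
    have hi' : ¬ dist (s i) 0 < ε := hi
    have hik : i.unpair.2 < k i.unpair.1 := by
      by_contra h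
      exact hi' (by simpa [s, h] using hε)
    have hiN : i.unpair.1 < N := by
      by_contra! h
      refine hi' (lt_of_le_of_lt ?_ hN)
      simp only [s, if_pos hik]
      rw [Real.dist_0_eq_abs, abs_of_nonneg (by positivity)]
      exact one_div_le_one_div_of_le (by positivity) (by gcongr)
    simp only [Set.mem_iUnion]
    exact ⟨_, hiN, _, hik, Nat.pair_unpair i⟩
  let f : OnePoint ℕ → ℝ := fun x => x.elim 0 s
  have hf : Continuous f := (OnePoint.continuous_iff_from_nat f).2 hs
  refine ⟨⟨f, hf⟩, fun n m => ?_⟩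
  have h₁ : f (Nat.pair n m : ℕ) = if m < k n then 1 / ((n : ℝ) + 1) else 0 := by
    change s (Nat.pair n m) = _
    simp [s]
  have h₂ : f OnePoint.infty = 0 := rfl
  have hn : (n : ℝ) + 1 ≠ 0 := by positivity
  simp only [Cp.entry, h₁, h₂]
  split_ifs
  · rw [sub_zero, mul_one_div_cancel hn]; norm_num
  · norm_num

/-- Every separable Banach space is a continuous image of `C_p` of the convergent sequence. -/
theorem Cp.exists_continuous_surjective_banach (E : Type*) [NormedAddCommGroup E]
    [NormedSpace ℝ E] [CompleteSpace E] [TopologicalSpace.SeparableSpace E] :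
    ∃ G : Cp (OnePoint ℕ) → E, Continuous G ∧ Function.Surjective G := by
  refine exists_continuous_surjective_of_selectors (TopologicalSpace.denseRange_denseSeq E)
    (g := fun n => weightedPath (Cp.entry n) (TopologicalSpace.denseSeq E))
    (fun n => continuous_weightedPath (Cp.continuous_entry n)
      (Cp.exists_eventually_entry_eq_zero n) _) fun k => ?_
  obtain ⟨f, hf⟩ := Cp.exists_entry_eq k
  exact ⟨f, fun n => weightedPath_eq (hf n) _⟩

/-- Let `X` be a compact metrizable space and `S = OnePoint ℕ` the convergent sequence
(the one-point compactification of the discrete natural numbers). Then there is a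
continuous surjection `H : C_p(S) → C_p(X)` (not required to be linear). -/
theorem stmt12 (X : Type) [TopologicalSpace X] [CompactSpace X]
    [TopologicalSpace.MetrizableSpace X] :
    ∃ H : ↥(Cp (OnePoint ℕ)) → ↥(Cp X),
      Continuous H ∧ Function.Surjective H := by
  let := TopologicalSpace.metrizableSpaceMetric X
  obtain ⟨G, hG, hGs⟩ := Cp.exists_continuous_surjective_banach C(X, ℝ)
  refine ⟨fun f => ⟨G f, (G f).continuous⟩, ?_, fun y => ?_⟩
  · exact Continuous.subtype_mk
      (continuous_pi fun x => (continuous_eval_const x).comp hG) _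
  · obtain ⟨f, hf⟩ := hGs ⟨y.1, y.2⟩
    exact ⟨f, Subtype.ext (congrArg DFunLike.coe hf)⟩
end

section
/- Let S be the convergent sequence, i.e., the one-point compactification of the natural numbers with the discrete topology. Then C_p(S) contains a closed subspace homeomorphic to the Baire space ℕ → ℕ (equivalently, to the space of irrational numbers). -/
open Filter Topology

/-- The function on the convergent sequence coding `x : ℕ → ℕ`: it vanishes at infinity, and its
value at the natural number coding `(n, k)` is `1 / (n + 1)` if `k < x n` and `0` otherwise. -/
noncomputable def baireCode (x : ℕ → ℕ) (s : OnePoint ℕ) : ℝ :=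
  s.elim 0 fun i => if i.unpair.2 < x i.unpair.1 then 1 / ((i.unpair.1 : ℝ) + 1) else 0

@[simp]
lemma baireCode_infty (x : ℕ → ℕ) : baireCode x OnePoint.infty = 0 := rfl

lemma baireCode_coe (x : ℕ → ℕ) (i : ℕ) : baireCode x (i : OnePoint ℕ) =
    if i.unpair.2 < x i.unpair.1 then 1 / ((i.unpair.1 : ℝ) + 1) else 0 := rfl

lemma baireCode_pair (x : ℕ → ℕ) (n k : ℕ) : baireCode x (Nat.pair n k : ℕ) =
    if k < x n then 1 / ((n : ℝ) + 1) else 0 := by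
  simp [baireCode_coe]

lemma continuous_baireCode (x : ℕ → ℕ) : Continuous (baireCode x) := by
  rw [OnePoint.continuous_iff_from_nat, baireCode_infty, Metric.tendsto_nhds,
    ← Nat.cofinite_eq_atTop]
  intro ε hε
  obtain ⟨N, hN⟩ := exists_nat_one_div_lt hε
  refine Set.Finite.subset (s := ⋃ n ∈ Set.Iio N, Nat.pair n '' Set.Iio (x n))
    ((Set.finite_Iio N).biUnion fun n _ => (Set.finite_Iio _).image _) fun i hi => ?_
  simp only [Set.mem_compl_iff, Set.mem_ofPred_eq, not_lt, dist_zero_right, baireCode_coe] at hi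
  split_ifs at hi with h
  · simp only [Set.mem_iUnion]
    refine ⟨i.unpair.1, ?_, i.unpair.2, h, Nat.pair_unpair i⟩
    by_contra! hle
    simp only [Set.mem_Iio, not_lt] at hle
    rw [Real.norm_of_nonneg (by positivity)] at hi
    exact (hi.trans (Nat.one_div_le_one_div hle)).not_gt hN
  · simp only [norm_zero] at hi
    exact absurd hi hε.not_ge

lemma baireCode_injective : Function.Injective baireCode := by
  intro x y hxy
  have key (n k : ℕ) : k < x n ↔ k < y n := by
    have h := congrFun hxy (Nat.pair n k : ℕ)
    rw [baireCode_pair, baireCode_pair] at h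
    have hn : (1 : ℝ) / (n + 1) ≠ 0 := by positivity
    split_ifs at h <;> first | exact absurd h hn | exact absurd h.symm hn | tauto
  funext n
  exact eq_of_forall_lt_iff (key n)

lemma continuous_baireCode_apply (s : OnePoint ℕ) : Continuous fun x => baireCode x s := by
  induction s using OnePoint.rec with
  | infty => exact continuous_const
  | coe i =>
    simp only [baireCode_coe]
    exact (continuous_of_discreteTopology (f := fun m : ℕ =>
      if i.unpair.2 < m then 1 / ((i.unpair.1 : ℝ) + 1) else 0)).comp (continuous_apply _)

/-- If `baireCode` converges pointwise to a continuous function along a filter, then every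
coordinate is eventually bounded along that filter. -/
lemma exists_eventually_le_of_tendsto_baireCode {l : Filter (ℕ → ℕ)} [l.NeBot]
    {g : OnePoint ℕ → ℝ} (hg : Continuous g)
    (h : ∀ s, Tendsto (fun x => baireCode x s) l (𝓝 (g s))) (n : ℕ) :
    ∃ k, ∀ᶠ x in l, x n ≤ k := by
  have h0 : g OnePoint.infty = 0 :=
    tendsto_nhds_unique (h OnePoint.infty) (by simp)
  have hpair : Tendsto (Nat.pair n) atTop atTop :=
    tendsto_atTop_mono (Nat.right_le_pair n) tendsto_id
  have hlim := ((OnePoint.continuous_iff_from_nat g).1 hg).comp hpair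
  rw [h0] at hlim
  have hn : (0 : ℝ) < 1 / (n + 1) := by positivity
  obtain ⟨k, hk⟩ := (hlim.eventually_lt_const hn).exists
  refine ⟨k, ((h _).eventually_lt_const hk).mono fun x hx => ?_⟩
  by_contra! hlt
  rw [baireCode_pair, if_pos hlt] at hx
  exact hx.false

/-- The coding map from the Baire space to `C_p` of the convergent sequence. -/
noncomputable def baireToCp (x : ℕ → ℕ) : Cp (OnePoint ℕ) := ⟨baireCode x, continuous_baireCode x⟩

lemma continuous_baireToCp : Continuous baireToCp :=
  Continuous.subtype_mk (continuous_pi continuous_baireCode_apply) _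

lemma isProperMap_baireToCp : IsProperMap baireToCp := by
  refine isProperMap_iff_ultrafilter_of_t2.2 ⟨continuous_baireToCp, fun U g hU => ?_⟩
  have hs (s : OnePoint ℕ) : Tendsto (fun x => baireCode x s) U (𝓝 ((g : OnePoint ℕ → ℝ) s)) :=
    (((continuous_apply s).comp continuous_subtype_val).tendsto g).comp hU
  choose b hb using exists_eventually_le_of_tendsto_baireCode g.2 hs
  have hlim (n : ℕ) : ∃ m, Tendsto (fun x : ℕ → ℕ => x n) U (𝓝 m) := by
    obtain ⟨m, -, hm⟩ := (Set.finite_Iic (b n)).isCompact.ultrafilter_le_nhds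
      (U.map fun x : ℕ → ℕ => x n) (le_principal_iff.2 (hb n))
    exact ⟨m, hm⟩
  choose y hy using hlim
  exact ⟨y, tendsto_pi_nhds.2 hy⟩

lemma isClosedEmbedding_baireToCp : IsClosedEmbedding baireToCp :=
  .of_continuous_injective_isClosedMap continuous_baireToCp
    (fun _ _ h => baireCode_injective (congrArg Subtype.val h)) isProperMap_baireToCp.isClosedMap

/-- Let `S = OnePoint ℕ` be the convergent sequence (the one-point compactification of
the discrete natural numbers). Then `C_p(S)` contains a closed subspace homeomorphic to
the Baire space `ℕ → ℕ`. -/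
theorem stmt13 :
    ∃ K : Set ↥(Cp (OnePoint ℕ)), IsClosed K ∧ Nonempty (K ≃ₜ (ℕ → ℕ)) := by
  exact ⟨Set.range baireToCp, isClosedEmbedding_baireToCp.isClosed_range,
    ⟨isClosedEmbedding_baireToCp.isEmbedding.toHomeomorph.symm⟩⟩
end
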